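/- Let d ≥ 1, q ≥ 0, 1 ≤ t ≤ 2^q and k ≥ 2 be integers, let m = 2^{q+1} − t, and suppose n ≥ d + (2^q·(k+1) − t) + 1. Let F be a family of nonempty subsets of {1, …, n+1} admitting a coloring c : F → {1,…,m} such that no 4 pairwise disjoint members of F receive the same color. Then for every continuous map f : Δ_n → ℝ^d there exist k pairs (S_1, T_1), …, (S_k, T_k) of disjoint subsets of {1,…,n+1} such that f(σ_{S_i}) ∩ f(σ_{T_i}) ≠ ∅ for each i (i.e., each pair is a Radon pair for f), and such that for every choice of two indices 1 ≤ i_1 < i_2 ≤ k and every choice of one set from each pair (A_{i_1} ∈ {S_{i_1}, T_{i_1}}, A_{i_2} ∈ {S_{i_2}, T_{i_2}}), the intersection A_{i_1} ∩ A_{i_2} contains no member of F. -/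

import Mathlib

noncomputable section

/-- The face of the standard simplex `Δ_n ⊆ ℝ^{n+1}` spanned by the vertices in `S`. -/
def simplexFace {n : ℕ} (S : Finset (Fin (n + 1))) : Set (Fin (n + 1) → ℝ) :=
  {x ∈ stdSimplex ℝ (Fin (n + 1)) | ∀ i ∉ S, x i = 0}

namespace RP
open Finset

/-! ### combinatorial part -/

abbrev Pt (k n : ℕ) := Fin k × Fin (n + 1) → ℤ

def yst {n : ℕ} (a : Fin (n + 1)) (ε : ℤˣ) (y : Fin (n + 1) → ℤ) : Fin (n + 1) → ℤ :=
  Function.update y a (y a + (ε : ℤ))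

theorem yst_same {n : ℕ} (a : Fin (n + 1)) (ε : ℤˣ) (y : Fin (n + 1) → ℤ) :
    yst a ε y a = y a + (ε : ℤ) := by simp [yst]

theorem yst_ne {n : ℕ} {a b : Fin (n + 1)} (h : b ≠ a) (ε : ℤˣ) (y : Fin (n + 1) → ℤ) :
    yst a ε y b = y b := by simp [yst, h]

theorem unit_cases (ε : ℤˣ) : (ε : ℤ) = 1 ∨ (ε : ℤ) = -1 := by
  rcases Int.units_eq_one_or ε with h | h <;> simp [h]

def sg {n : ℕ} (y : Fin (n + 1) → ℤ) : ℤˣ :=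
  if h : (univ.filter (fun a => y a ≠ 0)).Nonempty then
    (if 0 < y ((univ.filter (fun a => y a ≠ 0)).max' h) then 1 else -1) else 1

theorem sg_eq {n : ℕ} {y : Fin (n + 1) → ℤ} (a : Fin (n + 1)) (ha : y a ≠ 0)
    (hb : ∀ b, a < b → y b = 0) : sg y = if 0 < y a then 1 else -1 := by
  have hne : (univ.filter (fun a => y a ≠ 0)).Nonempty := ⟨a, by simp [ha]⟩
  have hm : (univ.filter (fun a => y a ≠ 0)).max' hne = a := by
    apply le_antisymm
    · apply Finset.max'_le
      intro b hb'
      simp only [mem_filter, mem_univ, true_and] at hb'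
      by_contra hlt
      exact hb' (hb b (not_le.mp hlt))
    · apply Finset.le_max'
      simp [ha]
  unfold sg
  rw [dif_pos hne, hm]

theorem exists_last {n : ℕ} {y : Fin (n + 1) → ℤ} (h : ∃ a, y a ≠ 0) :
    ∃ a, y a ≠ 0 ∧ ∀ b, a < b → y b = 0 := by
  obtain ⟨a, ha⟩ := h
  have hne : (univ.filter (fun a => y a ≠ 0)).Nonempty := ⟨a, by simp [ha]⟩
  refine ⟨(univ.filter (fun a => y a ≠ 0)).max' hne, ?_, ?_⟩
  · have := Finset.max'_mem _ hne
    simpa using this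
  · intro b hb
    by_contra hb'
    have := Finset.le_max' (univ.filter (fun a => y a ≠ 0)) b (by simp [hb'])
    exact absurd hb (not_lt.mpr this)

theorem sg_smul {n : ℕ} {y : Fin (n + 1) → ℤ} (h : ∃ a, y a ≠ 0) (u : ℤˣ) :
    sg (fun a => (u : ℤ) * y a) = u * sg y := by
  obtain ⟨a, ha, hb⟩ := exists_last h
  rw [sg_eq a ha hb]
  rw [sg_eq (y := fun a => (u : ℤ) * y a) a (by simp [ha]) (fun b hab => by simp [hb b hab])]
  rcases Int.units_eq_one_or u with h | h
  · simp [h]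
  · subst h
    by_cases h0 : 0 < y a
    · have : ¬ (y a < 0) := by omega
      simp [h0, this]
    · have : y a < 0 := by omega
      simp [h0, this]

def bit (u : ℤˣ) : ZMod 2 := if u = 1 then 0 else 1

theorem bit_mul (u v : ℤˣ) : bit (u * v) = bit u + bit v := by
  rcases Int.units_eq_one_or u with h | h <;> rcases Int.units_eq_one_or v with h' | h' <;>
    subst h <;> subst h' <;> decide

theorem z2 (x : ZMod 2) : x + x = 0 := CharTwo.add_self_eq_zero x

def TopB {n : ℕ} (R : ℤ) (m : ℕ) (y : Fin (n + 1) → ℤ) : Prop :=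
  ∃ a : Fin (n + 1), a.val ≤ m ∧ |y a| = R ∧
    (∀ b : Fin (n + 1), b.val ≤ m → b ≠ a → Odd (y b) ∧ |y b| ≤ R) ∧
    ∀ b : Fin (n + 1), m < b.val → y b = 0

def St {n : ℕ} (R : ℤ) (m : ℕ) (y : Fin (n + 1) → ℤ) (a₀ a : Fin (n + 1)) : Prop :=
  a₀ ≠ a ∧ a₀.val ≤ m ∧ a.val ≤ m ∧ |y a₀| = R ∧ Even (y a) ∧ |y a| ≤ R ∧
    (∀ b : Fin (n + 1), b.val ≤ m → b ≠ a → b ≠ a₀ → Odd (y b) ∧ |y b| ≤ R) ∧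
    ∀ b : Fin (n + 1), m < b.val → y b = 0

variable {n : ℕ} {R : ℤ} {m : ℕ}

theorem even_of_abs {x : ℤ} (hR : Even R) (h : |x| = R) : Even x := by
  rwa [← h, even_abs] at hR

theorem st_of_top (hR : Even R) (hR0 : 0 < R) {y : Fin (n + 1) → ℤ} {a : Fin (n + 1)} {ε : ℤˣ}
    (he : Even (y a)) (ht : TopB R m (yst a ε y)) : ∃ a₀, St R m y a₀ a := by
  obtain ⟨a₀, h1, h2, h3, h4⟩ := ht
  have hodd : Odd (yst a ε y a) := by
    rw [yst_same]
    rcases unit_cases ε with h | h <;> rw [h] <;> grind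
  have hne : a₀ ≠ a := by
    rintro rfl
    have := even_of_abs hR h2
    grind
  have ham : a.val ≤ m := by
    by_contra hh
    have := h4 a (by omega)
    rw [this] at hodd
    simp at hodd
  refine ⟨a₀, hne, h1, ham, by rwa [yst_ne hne] at h2, he, ?_, ?_, ?_⟩
  · have h5 := (h3 a ham hne.symm).2
    rw [yst_same, abs_le] at h5
    rw [abs_le]
    rcases unit_cases ε with h | h <;> rw [h] at h5 <;> grind
  · intro b hb hba hb0
    have := h3 b hb hb0
    rwa [yst_ne hba] at this
  · intro b hb
    have := h4 b hb
    rwa [yst_ne (by rintro rfl; omega)] at this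

/-- in the first case the covers are exactly the two changes at `a` -/
theorem cover_iff1 (hR : Even R) (hR0 : 0 < R) {y : Fin (n + 1) → ℤ} {a₀ a : Fin (n + 1)}
    (hs : St R m y a₀ a) (hlt : |y a| < R) (b : Fin (n + 1)) (ε : ℤˣ) :
    (Even (y b) ∧ TopB R m (yst b ε y)) ↔ b = a := by
  obtain ⟨h1, h2, h3, h4, h5, h6, h7, h8⟩ := hs
  constructor
  · rintro ⟨he, ht⟩
    obtain ⟨b₀, hb⟩ := st_of_top hR hR0 he ht
    obtain ⟨g1, g2, g3, g4, g5, g6, g7, g8⟩ := hb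
    by_contra hba
    by_cases hb0 : b = a₀
    · subst hb0
      have hb₀a : b₀ ≠ a := by rintro rfl; omega
      have := (h7 b₀ g2 hb₀a g1).1
      have := even_of_abs hR g4
      grind
    · have := (h7 b g3 hba hb0).1
      grind
  · rintro rfl
    refine ⟨h5, a₀, h2, by rwa [yst_ne h1], ?_, ?_⟩
    · intro c hc hca
      by_cases hcb : c = b
      · subst hcb
        rw [yst_same]
        rw [abs_lt] at hlt
        rw [abs_le]
        rcases unit_cases ε with h | h <;> rw [h] <;> grind
      · rw [yst_ne hcb]; exact h7 c hc hcb hca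
    · intro c hc
      rw [yst_ne (by rintro rfl; omega)]; exact h8 c hc

/-- inward direction -/
def inw (x : ℤ) : ℤˣ := if 0 < x then -1 else 1

theorem inw_spec {x : ℤ} (hR : Even R) (hR0 : 0 < R) (hx : |x| = R) (ε : ℤˣ) :
    |x + (ε : ℤ)| ≤ R ↔ ε = inw x := by
  unfold inw
  rcases Int.units_eq_one_or ε with h | h <;> subst h <;> rcases abs_cases x with h' | h' <;>
   split_ifs <;> simp [abs_le] <;> omega

theorem cover_iff2 (hR : Even R) (hR0 : 0 < R) {y : Fin (n + 1) → ℤ} {a₀ a : Fin (n + 1)}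
    (hs : St R m y a₀ a) (hlt : |y a| = R) (b : Fin (n + 1)) (ε : ℤˣ) :
    (Even (y b) ∧ TopB R m (yst b ε y)) ↔ (b, ε) = (a, inw (y a)) ∨ (b, ε) = (a₀, inw (y a₀)) := by
  have key : ∀ a₀ a : Fin (n + 1), St R m y a₀ a → |y a| = R →
      (Even (y a) ∧ TopB R m (yst a (inw (y a)) y)) := by
    rintro a₀ a ⟨h1, h2, h3, h4, h5, h6, h7, h8⟩ hlt
    refine ⟨h5, a₀, h2, by rwa [yst_ne h1], ?_, ?_⟩
    · intro c hc hca
      by_cases hcb : c = a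
      · subst hcb
        rw [yst_same]
        refine ⟨?_, (inw_spec hR hR0 hlt _).2 rfl⟩
        rcases unit_cases (inw (y c)) with h | h <;> rw [h] <;> grind
      · rw [yst_ne hcb]; exact h7 c hc hcb hca
    · intro c hc
      rw [yst_ne (by rintro rfl; omega)]; exact h8 c hc
  have hs' := hs
  obtain ⟨h1, h2, h3, h4, h5, h6, h7, h8⟩ := hs
  constructor
  · rintro ⟨he, ht⟩
    obtain ⟨b₀, hb⟩ := st_of_top hR hR0 he ht
    obtain ⟨g1, g2, g3, g4, g5, g6, g7, g8⟩ := hb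
    have hab : b = a ∨ b = a₀ := by
      by_contra hcon
      push Not at hcon
      have := (h7 b g3 hcon.1 hcon.2).1
      grind
    have habs : |y b| = R := by rcases hab with rfl | rfl <;> assumption
    obtain ⟨a₁, k1, k2, k3, k4⟩ := ht
    have hba : b ≠ a₁ := by
      rintro rfl
      rw [yst_same] at k2
      have := even_of_abs hR k2
      rcases unit_cases ε with h | h <;> rw [h] at this <;> grind
    have := (k3 b g3 hba).2
    rw [yst_same, inw_spec hR hR0 habs] at this
    rcases hab with rfl | rfl
    · left; rw [this]
    · right; rw [this]
  · rintro (h | h)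
    · obtain ⟨rfl, rfl⟩ := Prod.mk.inj h
      exact key _ _ hs' hlt
    · obtain ⟨rfl, rfl⟩ := Prod.mk.inj h
      refine key a _ ⟨h1.symm, h3, h2, hlt, even_of_abs hR h4, h4.le, ?_, h8⟩ h4
      intro c hc hca hcb
      exact h7 c hc hcb hca

open Classical in
theorem blockA (hR : Even R) (hR0 : 0 < R) (y : Fin (n + 1) → ℤ) :
    ∑ b : Fin (n + 1), ∑ ε : ℤˣ,
      (if Even (y b) ∧ TopB R m (yst b ε y) then (1 : ZMod 2) else 0) = 0 := by
  by_cases hst : ∃ a₀ a, St R m y a₀ a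
  · obtain ⟨a₀, a, hs⟩ := hst
    rcases lt_or_eq_of_le hs.2.2.2.2.2.1 with hlt | heq
    · simp_rw [cover_iff1 hR hR0 hs hlt]
      apply Finset.sum_eq_zero
      intro b _
      rw [Finset.sum_const]
      rw [show (univ : Finset ℤˣ).card = 2 from rfl, two_nsmul, z2]
    · simp_rw [cover_iff2 hR hR0 hs heq]
      rw [← Fintype.sum_prod_type' (f := fun b ε => if (b, ε) = (a, inw (y a)) ∨ (b, ε) = (a₀, inw (y a₀)) then (1 : ZMod 2) else 0)]
      rw [← Finset.sum_filter, Finset.sum_const]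
      have : (univ.filter (fun x : Fin (n+1) × ℤˣ => (x.1, x.2) = (a, inw (y a)) ∨ (x.1, x.2) = (a₀, inw (y a₀))))
        = {(a, inw (y a)), (a₀, inw (y a₀))} := by
        ext x; simp
      rw [this, Finset.card_pair (by simp [hs.1.symm]), two_nsmul, z2]
  · apply Finset.sum_eq_zero
    intro b _
    apply Finset.sum_eq_zero
    intro ε _
    rw [if_neg]
    rintro ⟨h1, h2⟩
    obtain ⟨a₀, h⟩ := st_of_top hR hR0 h1 h2
    exact hst ⟨a₀, b, h⟩

open Classical in
theorem blockB (hR : Even R) (hR0 : 0 < R) (hm : m ≤ n) (y : Fin (n + 1) → ℤ) :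
    ∑ b : Fin (n + 1), ∑ ε : ℤˣ,
      (if Even (y b) ∧ TopB R m (yst b ε y) then bit (sg y) + bit (sg (yst b ε y)) else 0)
      = if 1 ≤ m ∧ TopB R (m - 1) y then 1 else 0 := by
  set l : Fin (n + 1) := ⟨m, by omega⟩ with hl
  have hlast : ∀ b : Fin (n + 1), l < b → m < b.val := fun b hb => hb
  by_cases hym : y l = 0
  · by_cases hst : ∃ a₀ a, St R m y a₀ a
    · obtain ⟨a₀, a, hs⟩ := hst
      have hs' := hs
      obtain ⟨h1, h2, h3, h4, h5, h6, h7, h8⟩ := hs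
      have hl0 : l ≠ a₀ := by
        intro h
        rw [← h, hym] at h4
        simp at h4; omega
      have hla : l = a := by
        by_contra hla
        have := (h7 l le_rfl hla hl0).1
        rw [hym] at this
        simp at this
      rw [← hla] at hs' h1 h3 h5 h7
      simp_rw [cover_iff1 hR hR0 hs' (by rw [hym]; simpa using hR0)]
      rw [Finset.sum_eq_single l]
      · have e1 : sg (yst l 1 y) = 1 := by
          rw [sg_eq l (by rw [yst_same, hym]; simp)]
          · rw [yst_same, hym]; simp
          · intro b hb
            rw [yst_ne hb.ne']; exact h8 b hb
        have e2 : sg (yst l (-1) y) = -1 := by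
          rw [sg_eq l (by rw [yst_same, hym]; simp)]
          · rw [yst_same, hym]; simp
          · intro b hb
            rw [yst_ne hb.ne']; exact h8 b hb
        have hu : (univ : Finset ℤˣ) = {1, -1} := rfl
        have hlv : l.val = m := rfl
        have h0l : a₀.val ≠ m := fun h => h1 (Fin.ext h)
        rw [hu, Finset.sum_pair (by decide), if_pos rfl, if_pos rfl, e1, e2, if_pos]
        · have : bit 1 = 0 := rfl
          have h' : bit (-1) = 1 := rfl
          rw [this, h']
          linear_combination z2 (bit (sg y))
        · refine ⟨by omega, a₀, by omega, h4, ?_, ?_⟩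
          · intro b hb hba
            exact h7 b (by omega) (by rintro rfl; omega) hba
          · intro b hb
            by_cases hbl : b = l
            · rw [hbl, hym]
            · have : b.val ≠ m := fun h => hbl (Fin.ext h)
              exact h8 b (by omega)
      · intro b _ hb
        simp [hb]
      · simp
    · rw [if_neg]
      · apply Finset.sum_eq_zero
        intro b _
        apply Finset.sum_eq_zero
        intro ε _
        rw [if_neg]
        rintro ⟨h1, h2⟩
        obtain ⟨a₀, h⟩ := st_of_top hR hR0 h1 h2
        exact hst ⟨a₀, b, h⟩
      · rintro ⟨hm1, a₀, h1, h2, h3, h4⟩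
        apply hst
        refine ⟨a₀, l, ?_, by omega, le_rfl, h2, by rw [hym]; simp, by rw [hym]; simpa using hR0.le, ?_, ?_⟩
        · rintro rfl
          have : l.val = m := rfl
          omega
        · intro b hb hbl hba
          have : b.val ≠ m := fun h => hbl (Fin.ext h)
          exact h3 b (by omega) hba
        · intro b hb
          exact h4 b (by omega)
  · rw [if_neg]
    · apply Finset.sum_eq_zero
      intro b _
      apply Finset.sum_eq_zero
      intro ε _
      split_ifs with hc
      · obtain ⟨he, ht⟩ := hc
        obtain ⟨a₀, h⟩ := st_of_top hR hR0 he ht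
        obtain ⟨h1, h2, h3, h4, h5, h6, h7, h8⟩ := h
        rw [sg_eq l hym (fun c hc => h8 c hc)]
        have hz : ∀ c, l < c → yst b ε y c = 0 := by
          intro c hc
          rw [yst_ne (by rintro rfl; have := hlast _ hc; omega)]; exact h8 c hc
        by_cases hbl : b = l
        · rw [hbl] at hz he ⊢
          have hnz : yst l ε y l ≠ 0 := by
            rw [yst_same]
            rcases unit_cases ε with h | h <;> rw [h] <;> grind
          rw [sg_eq l hnz hz, yst_same]
          have : (0 < y l + (ε : ℤ)) ↔ 0 < y l := by
            rcases unit_cases ε with h | h <;> rw [h] <;> grind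
          simp only [this]
          exact z2 _
        · rw [sg_eq l (by rwa [yst_ne (Ne.symm hbl)]) hz, yst_ne (Ne.symm hbl)]
          exact z2 _
      · rfl
    · rintro ⟨hm1, a₀, h1, h2, h3, h4⟩
      exact hym (h4 l (by change m - 1 < m; omega))

end RP

namespace RP
open Finset

variable {k n : ℕ} {R : ℤ}

def stp (c : Fin k × Fin (n + 1)) (ε : ℤˣ) (p : Pt k n) : Pt k n :=
  Function.update p c (p c + (ε : ℤ))

theorem stp_same (c : Fin k × Fin (n + 1)) (ε : ℤˣ) (p : Pt k n) :
    stp c ε p c = p c + (ε : ℤ) := by simp [stp]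

theorem stp_ne {c b : Fin k × Fin (n + 1)} (h : b ≠ c) (ε : ℤˣ) (p : Pt k n) :
    stp c ε p b = p b := by simp [stp, h]

theorem stp_block_same (i : Fin k) (a : Fin (n + 1)) (ε : ℤˣ) (p : Pt k n) :
    (fun b => stp (i, a) ε p (i, b)) = yst a ε (fun b => p (i, b)) := by
  funext b
  by_cases h : b = a
  · subst h; rw [stp_same, yst_same]
  · rw [stp_ne (by simp [h]), yst_ne h]

theorem stp_block_ne {i j : Fin k} (h : j ≠ i) (a : Fin (n + 1)) (ε : ℤˣ) (p : Pt k n) :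
    (fun b => stp (i, a) ε p (j, b)) = (fun b => p (j, b)) := by
  funext b
  rw [stp_ne (by simp [h])]

theorem odd_add_unit {x : ℤ} (ε : ℤˣ) : Odd (x + (ε : ℤ)) ↔ Even x := by
  rcases unit_cases ε with h | h <;> rw [h] <;> grind

theorem even_add_unit {x : ℤ} (ε : ℤˣ) : Even (x + (ε : ℤ)) ↔ Odd x := by
  rcases unit_cases ε with h | h <;> rw [h] <;> grind

theorem stp_comm {c c' : Fin k × Fin (n + 1)} (h : c ≠ c') (ε ε' : ℤˣ) (p : Pt k n) :
    stp c ε (stp c' ε' p) = stp c' ε' (stp c ε p) := by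
  unfold stp
  rw [Function.update_of_ne h, Function.update_of_ne h.symm, Function.update_comm h]

theorem stp_neg (c : Fin k × Fin (n + 1)) (ε : ℤˣ) (p : Pt k n) :
    stp c (-ε) (stp c ε p) = p := by
  funext b
  by_cases h : b = c
  · subst h; rw [stp_same, stp_same]; simp
  · rw [stp_ne h, stp_ne h]

open Classical in
def bd (φ : Pt k n → ZMod 2) (w : Pt k n) : ZMod 2 :=
  ∑ x : (Fin k × Fin (n + 1)) × ℤˣ, if Odd (w x.1) then φ (stp x.1 x.2 w) else 0

theorem bd_add (φ ψ : Pt k n → ZMod 2) (w : Pt k n) :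
    bd (fun p => φ p + ψ p) w = bd φ w + bd ψ w := by
  unfold bd
  rw [← Finset.sum_add_distrib]
  apply Finset.sum_congr rfl
  intro x _
  split_ifs <;> simp

theorem bd_sum {α : Type*} (s : Finset α) (φ : α → Pt k n → ZMod 2) (w : Pt k n) :
    bd (fun p => ∑ i ∈ s, φ i p) w = ∑ i ∈ s, bd (φ i) w := by
  unfold bd
  rw [Finset.sum_comm]
  apply Finset.sum_congr rfl
  intro x _
  split_ifs <;> simp

theorem bd_one (w : Pt k n) : bd (fun _ => 1) w = 0 := by
  unfold bd
  rw [Fintype.sum_prod_type]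
  apply Finset.sum_eq_zero
  intro c _
  dsimp only
  by_cases h : Odd (w c)
  · simp only [if_pos h]
    rw [Finset.sum_const, show (univ : Finset ℤˣ).card = 2 from rfl, two_nsmul, z2]
  · simp [h]

theorem bd_bd (φ : Pt k n → ZMod 2) (w : Pt k n) : bd (bd φ) w = 0 := by
  classical
  unfold bd
  have h1 : ∀ x : (Fin k × Fin (n + 1)) × ℤˣ,
    (if Odd (w x.1) then ∑ y : (Fin k × Fin (n + 1)) × ℤˣ,
        if Odd (stp x.1 x.2 w y.1) then φ (stp y.1 y.2 (stp x.1 x.2 w)) else 0 else 0)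
     = ∑ y : (Fin k × Fin (n + 1)) × ℤˣ, if Odd (w x.1) ∧ Odd (w y.1) ∧ y.1 ≠ x.1 then
        φ (stp y.1 y.2 (stp x.1 x.2 w)) else 0 := by
    intro x
    by_cases hx : Odd (w x.1)
    · rw [if_pos hx]
      apply Finset.sum_congr rfl
      intro y _
      by_cases hxy : y.1 = x.1
      · rw [if_neg (by rw [hxy, stp_same, odd_add_unit]; grind), if_neg (by tauto)]
      · rw [stp_ne hxy]
        simp [hx, hxy]
    · simp [hx]
  rw [Finset.sum_congr rfl (fun x _ => h1 x)]
  rw [← Fintype.sum_prod_type' (f := fun x y : (Fin k × Fin (n + 1)) × ℤˣ =>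
    if Odd (w x.1) ∧ Odd (w y.1) ∧ y.1 ≠ x.1 then φ (stp y.1 y.2 (stp x.1 x.2 w)) else 0)]
  apply Finset.sum_involution (fun z _ => (z.2, z.1))
  · rintro ⟨x, y⟩ _
    dsimp only
    by_cases hxy : y.1 = x.1
    · rw [if_neg (by tauto), if_neg (by rw [hxy]; tauto)]; simp
    · rw [stp_comm hxy]
      have : (Odd (w x.1) ∧ Odd (w y.1) ∧ y.1 ≠ x.1) ↔ (Odd (w y.1) ∧ Odd (w x.1) ∧ x.1 ≠ y.1) := by
        constructor
        · rintro ⟨h1, h2, h3⟩; exact ⟨h2, h1, h3.symm⟩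
        · rintro ⟨h1, h2, h3⟩; exact ⟨h2, h1, h3.symm⟩
      simp only [this]
      exact z2 _
  · rintro ⟨x, y⟩ _ hne heq
    apply hne
    have : y = x := by simpa using congrArg Prod.fst heq
    subst this
    simp
  · intros; simp
  · intros; simp

def W : List (Pt k n → ZMod 2) → Pt k n → ZMod 2
  | [] => fun _ => 1
  | s :: L => bd (fun p => s p * W L p)

theorem bd_W (L : List (Pt k n → ZMod 2)) (w : Pt k n) : bd (W L) w = 0 := by
  cases L with
  | nil => exact bd_one w
  | cons s L => exact bd_bd _ w

open Classical in
theorem bd_mul_W (s : Pt k n → ZMod 2) (L : List (Pt k n → ZMod 2)) (w : Pt k n) :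
    bd (fun p => s p * W L p) w = ∑ x : (Fin k × Fin (n + 1)) × ℤˣ,
      if Odd (w x.1) then W L (stp x.1 x.2 w) * (s (stp x.1 x.2 w) + s w) else 0 := by
  have h := bd_W L w
  have h2 : bd (fun p => s p * W L p) w = bd (fun p => s p * W L p) w + s w * bd (W L) w := by
    rw [h]; simp
  rw [h2]
  unfold bd
  rw [Finset.mul_sum, ← Finset.sum_add_distrib]
  apply Finset.sum_congr rfl
  intro x _
  split_ifs
  · ring
  · simp

def act (g : Fin k → ℤˣ) (p : Pt k n) : Pt k n := fun c => (g c.1 : ℤ) * p c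

theorem act_stp (g : Fin k → ℤˣ) (c : Fin k × Fin (n + 1)) (ε : ℤˣ) (p : Pt k n) :
    act g (stp c ε p) = stp c (g c.1 * ε) (act g p) := by
  funext b
  by_cases h : b = c
  · subst h; simp only [act, stp_same]; push_cast; ring
  · rw [stp_ne h]; simp only [act]; rw [stp_ne h]

theorem act_act (g h : Fin k → ℤˣ) (p : Pt k n) : act g (act h p) = act (g * h) p := by
  funext c; simp [act, mul_assoc]

theorem act_one (p : Pt k n) : act 1 p = p := by
  funext c; simp [act]

theorem act_self (g : Fin k → ℤˣ) (p : Pt k n) : act g (act g p) = p := by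
  rw [act_act]
  have : g * g = 1 := by funext i; exact Int.units_mul_self (g i)
  rw [this, act_one]

theorem odd_act (g : Fin k → ℤˣ) (p : Pt k n) (c : Fin k × Fin (n + 1)) :
    Odd (act g p c) ↔ Odd (p c) := by
  unfold act
  rcases unit_cases (g c.1) with h | h <;> rw [h] <;> simp

theorem abs_act (g : Fin k → ℤˣ) (p : Pt k n) (c : Fin k × Fin (n + 1)) :
    |act g p c| = |p c| := by
  unfold act
  rcases unit_cases (g c.1) with h | h <;> rw [h] <;> simp

def Good (R : ℤ) (p : Pt k n) : Prop := ∀ i, ∃ a, |p (i, a)| = R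

theorem good_act {g : Fin k → ℤˣ} {p : Pt k n} (h : Good R p) : Good R (act g p) := by
  intro i
  obtain ⟨a, ha⟩ := h i
  exact ⟨a, by rw [abs_act, ha]⟩

theorem good_stp (hR : Even R) {p : Pt k n} (h : Good R p) {c : Fin k × Fin (n + 1)} (hc : Odd (p c))
    (ε : ℤˣ) : Good R (stp c ε p) := by
  intro i
  obtain ⟨a, ha⟩ := h i
  refine ⟨a, ?_⟩
  rw [stp_ne]
  · exact ha
  · rintro rfl
    have := even_of_abs hR ha
    grind

theorem good_nz (hR0 : 0 < R) {p : Pt k n} (h : Good R p) (i : Fin k) : ∃ a, p (i, a) ≠ 0 := by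
  obtain ⟨a, ha⟩ := h i
  refine ⟨a, ?_⟩
  intro h0
  rw [h0] at ha
  simp at ha
  omega

def gs (p : Pt k n) : Fin k → ℤˣ := fun i => sg (fun a => p (i, a))

theorem gs_act (hR0 : 0 < R) {p : Pt k n} (h : Good R p) (g : Fin k → ℤˣ) :
    gs (act g p) = g * gs p := by
  funext i
  exact sg_smul (good_nz hR0 h i) (g i)

def Inv (R : ℤ) (φ : Pt k n → ZMod 2) : Prop := ∀ p, Good R p → ∀ g, φ (act g p) = φ p

def Ty (R : ℤ) (χ : Finset (Fin k)) (s : Pt k n → ZMod 2) : Prop :=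
  ∀ p, Good R p → ∀ g : Fin k → ℤˣ, s (act g p) = s p + ∑ i ∈ χ, bit (g i)

def s0 (χ : Finset (Fin k)) (p : Pt k n) : ZMod 2 := ∑ i ∈ χ, bit (gs p i)

theorem ty_s0 (hR0 : 0 < R) (χ : Finset (Fin k)) : Ty (n := n) R χ (s0 χ) := by
  intro p hp g
  unfold s0
  rw [gs_act hR0 hp, ← Finset.sum_add_distrib]
  apply Finset.sum_congr rfl
  intro i _
  rw [Pi.mul_apply, bit_mul, add_comm]

theorem ty_add {χ : Finset (Fin k)} {s s' : Pt k n → ZMod 2} (h : Ty R χ s) (h' : Ty R χ s') :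
    Inv R (fun p => s p + s' p) := by
  intro p hp g
  dsimp only
  rw [h p hp, h' p hp]
  linear_combination z2 (∑ i ∈ χ, bit (g i))

theorem inv_W (hR : Even R) (L : List (Pt k n → ZMod 2)) (hL : ∀ s ∈ L, ∃ χ, Ty R χ s) :
    Inv R (W L) := by
  induction L with
  | nil => intro p _ g; rfl
  | cons s L ih =>
    have ih' := ih (fun t ht => hL t (by simp [ht]))
    obtain ⟨χ, hχ⟩ := hL s (by simp)
    intro p hp g
    change bd (fun p => s p * W L p) _ = bd (fun p => s p * W L p) _
    rw [bd_mul_W, bd_mul_W]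
    conv_lhs => rw [Fintype.sum_prod_type]
    conv_rhs => rw [Fintype.sum_prod_type]
    apply Finset.sum_congr rfl
    intro c _
    symm
    apply Fintype.sum_equiv (Equiv.mulLeft (g c.1))
    intro ε
    dsimp only [Equiv.coe_mulLeft]
    rw [← act_stp]
    by_cases hc : Odd (p c)
    · rw [if_pos hc, if_pos ((odd_act g p c).2 hc)]
      have hg := good_stp hR hp hc ε
      rw [ih' _ hg, hχ _ hg, hχ _ hp]
      linear_combination (-W L (stp c ε p)) * z2 (∑ i ∈ χ, bit (g i))
    · rw [if_neg hc, if_neg (by rwa [odd_act])]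

def Top (R : ℤ) (e : Fin k →₀ ℕ) (p : Pt k n) : Prop := ∀ i, TopB R (e i) (fun a => p (i, a))

open Classical in
theorem coverA (hR : Even R) (hR0 : 0 < R) (e : Fin k →₀ ℕ) (v : Pt k n) :
    ∑ x : (Fin k × Fin (n + 1)) × ℤˣ,
      (if Even (v x.1) ∧ Top R e (stp x.1 x.2 v) then (1 : ZMod 2) else 0) = 0 := by
  rw [Fintype.sum_prod_type, Fintype.sum_prod_type]
  apply Finset.sum_eq_zero
  intro i _
  by_cases h : ∀ j, j ≠ i → TopB R (e j) (fun a => v (j, a))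
  · refine Eq.trans ?_ (blockA (m := e i) hR hR0 (fun a => v (i, a)))
    apply Finset.sum_congr rfl
    intro a _
    apply Finset.sum_congr rfl
    intro ε _
    dsimp only
    congr 1
    rw [← stp_block_same, eq_iff_iff]
    apply and_congr_right
    intro _
    constructor
    · intro ht; exact ht i
    · intro ht j
      by_cases hj : j = i
      · subst hj; exact ht
      · rw [stp_block_ne hj]; exact h j hj
  · apply Finset.sum_eq_zero
    intro a _
    apply Finset.sum_eq_zero
    intro ε _
    rw [if_neg]
    rintro ⟨_, ht⟩
    apply h
    intro j hj
    have := ht j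
    rwa [stp_block_ne hj] at this

open Classical in
theorem coverB (hR : Even R) (hR0 : 0 < R) (e : Fin k →₀ ℕ) (he : ∀ i, e i ≤ n) (v : Pt k n)
    (i₀ : Fin k) :
    ∑ x : (Fin k × Fin (n + 1)) × ℤˣ,
      (if Even (v x.1) ∧ Top R e (stp x.1 x.2 v) then
        bit (gs v i₀) + bit (gs (stp x.1 x.2 v) i₀) else 0)
      = if 1 ≤ e i₀ ∧ Top R (e - Finsupp.single i₀ 1) v then 1 else 0 := by
  rw [Fintype.sum_prod_type, Fintype.sum_prod_type]
  rw [Finset.sum_eq_single i₀]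
  · by_cases h : ∀ j, j ≠ i₀ → TopB R (e j) (fun a => v (j, a))
    · have hB := blockB (m := e i₀) hR hR0 (he i₀) (fun a => v (i₀, a))
      have hTop : (1 ≤ e i₀ ∧ Top R (e - Finsupp.single i₀ 1) v) ↔
          (1 ≤ e i₀ ∧ TopB R (e i₀ - 1) (fun a => v (i₀, a))) := by
        apply and_congr_right
        intro _
        constructor
        · intro ht
          have := ht i₀
          simpa using this
        · intro ht j
          by_cases hj : j = i₀
          · subst hj; simpa using ht
          · have : (e - Finsupp.single i₀ 1 : Fin k →₀ ℕ) j = e j := by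
              simp [Finsupp.single_apply, Ne.symm hj]
            rw [this]; exact h j hj
      simp only [hTop]
      rw [← hB]
      apply Finset.sum_congr rfl
      intro a _
      apply Finset.sum_congr rfl
      intro ε _
      have hc : (Even (v (i₀, a)) ∧ Top R e (stp (i₀, a) ε v)) ↔
          (Even (v (i₀, a)) ∧ TopB R (e i₀) (yst a ε (fun a => v (i₀, a)))) := by
        rw [← stp_block_same]
        apply and_congr_right
        intro _
        constructor
        · intro ht; exact ht i₀
        · intro ht j
          by_cases hj : j = i₀
          · subst hj; exact ht
          · rw [stp_block_ne hj]; exact h j hj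
      simp only [hc]
      congr 2
      unfold gs
      rw [stp_block_same]
    · rw [if_neg]
      · apply Finset.sum_eq_zero
        intro a _
        apply Finset.sum_eq_zero
        intro ε _
        rw [if_neg]
        rintro ⟨_, ht⟩
        apply h
        intro j hj
        have := ht j
        rwa [stp_block_ne hj] at this
      · rintro ⟨_, ht⟩
        apply h
        intro j hj
        have := ht j
        have h' : (e - Finsupp.single i₀ 1 : Fin k →₀ ℕ) j = e j := by
          simp [Finsupp.single_apply, Ne.symm hj]
        rwa [h'] at this
  · intro i _ hi
    apply Finset.sum_eq_zero
    intro a _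
    apply Finset.sum_eq_zero
    intro ε _
    have : gs (stp (i, a) ε v) i₀ = gs v i₀ := by
      unfold gs
      rw [stp_block_ne (Ne.symm hi)]
    dsimp only
    rw [this, z2]
    simp
  · simp

theorem top_good {e : Fin k →₀ ℕ} {p : Pt k n} (h : Top R e p) : Good R p := by
  intro i
  obtain ⟨a, _, ha, _⟩ := h i
  exact ⟨a, ha⟩

theorem top_box (hR0 : 0 < R) {e : Fin k →₀ ℕ} {p : Pt k n} (h : Top R e p) (c) : |p c| ≤ R := by
  obtain ⟨i, b⟩ := c
  obtain ⟨a, h1, h2, h3, h4⟩ := h i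
  by_cases hb : b.val ≤ e i
  · by_cases hba : b = a
    · subst hba; exact h2.le
    · exact (h3 b hb hba).2
  · have := h4 b (by omega)
    dsimp only at this
    rw [this]; simpa using hR0.le

theorem top_act {e : Fin k →₀ ℕ} {p : Pt k n} (h : Top R e p) (g : Fin k → ℤˣ) :
    Top R e (act g p) := by
  intro i
  obtain ⟨a, h1, h2, h3, h4⟩ := h i
  refine ⟨a, h1, by dsimp only; rw [abs_act]; exact h2, ?_, ?_⟩
  · intro b hb hba
    dsimp only
    rw [abs_act, odd_act]; exact h3 b hb hba
  · intro b hb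
    have := h4 b hb
    dsimp only at this ⊢
    simp [act, this]

def Box (k n : ℕ) (R : ℤ) : Finset (Pt k n) := Fintype.piFinset (fun _ => Finset.Icc (-R) R)

theorem mem_box {p : Pt k n} : p ∈ Box k n R ↔ ∀ c, |p c| ≤ R := by
  simp [Box, abs_le]

theorem box_stp (hR : Even R) {p : Pt k n} (h : ∀ c, |p c| ≤ R) {c : Fin k × Fin (n + 1)}
    (hc : Odd (p c)) (ε : ℤˣ) (b) : |stp c ε p b| ≤ R := by
  by_cases hb : b = c
  · subst hb
    rw [stp_same]
    have := h b
    rw [abs_le] at this ⊢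
    rcases unit_cases ε with h | h <;> rw [h] <;> grind
  · rw [stp_ne hb]; exact h b

open Classical in
theorem reindex (hR : Even R) (hR0 : 0 < R) (e : Fin k →₀ ℕ) (K : Pt k n → Pt k n → ZMod 2)
    (hK : ∀ v w, Good R v → Good R w → ∀ g, K (act g v) (act g w) = K v w) :
    ∑ w ∈ (Box k n R).filter (fun w => Top R e w ∧ gs w = 1),
      ∑ x : (Fin k × Fin (n + 1)) × ℤˣ, (if Odd (w x.1) then K (stp x.1 x.2 w) w else 0)
    = ∑ v ∈ (Box k n R).filter (fun w => gs w = 1),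
      ∑ x : (Fin k × Fin (n + 1)) × ℤˣ,
        (if Even (v x.1) ∧ Top R e (stp x.1 x.2 v) then K v (stp x.1 x.2 v) else 0) := by
  rw [← Finset.sum_product', ← Finset.sum_product']
  rw [← Finset.sum_filter, ← Finset.sum_filter]
  let Φ : Pt k n × ((Fin k × Fin (n + 1)) × ℤˣ) → Pt k n × ((Fin k × Fin (n + 1)) × ℤˣ) :=
    fun z => (act (gs (stp z.2.1 z.2.2 z.1)) (stp z.2.1 z.2.2 z.1),
      (z.2.1, -(gs (stp z.2.1 z.2.2 z.1) z.2.1.1 * z.2.2)))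
  have hstep : ∀ z, stp (Φ z).2.1 (Φ z).2.2 (Φ z).1 = act (gs (stp z.2.1 z.2.2 z.1)) z.1 := by
    intro z
    dsimp only [Φ]
    rw [act_stp, stp_neg]
  have hinv : ∀ z : Pt k n × ((Fin k × Fin (n + 1)) × ℤˣ), Good R z.1 → gs z.1 = 1 →
      Φ (Φ z) = z := by
    intro z hz hz1
    have h1 := hstep z
    have h2 : gs (stp (Φ z).2.1 (Φ z).2.2 (Φ z).1) = gs (stp z.2.1 z.2.2 z.1) := by
      rw [h1, gs_act hR0 hz, hz1, mul_one]
    apply Prod.ext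
    · change act (gs (stp (Φ z).2.1 (Φ z).2.2 (Φ z).1)) (stp (Φ z).2.1 (Φ z).2.2 (Φ z).1) = z.1
      rw [h2, h1, act_self]
    · apply Prod.ext
      · rfl
      · change -(gs (stp (Φ z).2.1 (Φ z).2.2 (Φ z).1) z.2.1.1 * -(gs (stp z.2.1 z.2.2 z.1) z.2.1.1 * z.2.2)) = z.2.2
        rw [h2, mul_neg, neg_neg, ← mul_assoc, Int.units_mul_self, one_mul]
  have hgs : ∀ p : Pt k n, Good R p → gs (act (gs p) p) = 1 := by
    intro p hp
    rw [gs_act hR0 hp]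
    funext i; exact Int.units_mul_self _
  have goodv : ∀ (c : Fin k × Fin (n + 1)) (ε : ℤˣ) (v : Pt k n), Even (v c) → Good R (stp c ε v) →
      Good R v := by
    intro c ε v hc hg
    have := good_stp hR hg (c := c) (by rw [stp_same, odd_add_unit]; exact hc) (-ε)
    rwa [stp_neg] at this
  apply Finset.sum_bij' (fun z _ => Φ z) (fun z _ => Φ z)
  · rintro ⟨w, c, ε⟩ hz
    simp only [mem_filter, mem_product, mem_univ, and_true, mem_box] at hz
    obtain ⟨⟨hb, ht, hg⟩, ho⟩ := hz
    have hgood := good_stp hR (top_good ht) ho ε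
    rw [mem_filter, mem_product]
    refine ⟨⟨?_, mem_univ _⟩, ?_, ?_⟩
    · rw [mem_filter, mem_box]
      refine ⟨fun b => ?_, hgs _ hgood⟩
      dsimp only [Φ]
      rw [abs_act]
      exact box_stp hR hb ho ε b
    · dsimp only [Φ]
      rw [← Int.not_odd_iff_even, odd_act, stp_same, odd_add_unit]
      grind
    · rw [hstep]; exact top_act ht _
  · rintro ⟨v, c, ε⟩ hz
    simp only [mem_filter, mem_product, mem_univ, and_true, mem_box] at hz
    obtain ⟨⟨hb, hg⟩, he, ht⟩ := hz
    rw [mem_filter, mem_product]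
    refine ⟨⟨?_, mem_univ _⟩, ?_⟩
    · rw [mem_filter, mem_box]
      exact ⟨top_box hR0 (top_act ht _), top_act ht _, hgs _ (top_good ht)⟩
    · dsimp only [Φ]
      rw [odd_act, stp_same, odd_add_unit]; exact he
  · rintro ⟨w, c, ε⟩ hz
    simp only [mem_filter, mem_product, mem_univ, and_true, mem_box] at hz
    obtain ⟨⟨hb, ht, hg⟩, ho⟩ := hz
    exact hinv _ (top_good ht) hg
  · rintro ⟨v, c, ε⟩ hz
    simp only [mem_filter, mem_product, mem_univ, and_true, mem_box] at hz
    obtain ⟨⟨hb, hg⟩, he, ht⟩ := hz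
    exact hinv _ (goodv _ _ _ he (top_good ht)) hg
  · rintro ⟨w, c, ε⟩ hz
    simp only [mem_filter, mem_product, mem_univ, and_true, mem_box] at hz
    obtain ⟨⟨hb, ht, hg⟩, ho⟩ := hz
    rw [hstep]
    dsimp only [Φ]
    rw [hK _ _ (good_stp hR (top_good ht) ho ε) (top_good ht)]

open Classical in
def E (R : ℤ) (e : Fin k →₀ ℕ) (L : List (Pt k n → ZMod 2)) : ZMod 2 :=
  ∑ w ∈ (Box k n R).filter (fun w => Top R e w ∧ gs w = 1), W L w

theorem E_cons (hR : Even R) (hR0 : 0 < R) (e : Fin k →₀ ℕ) (he : ∀ i, e i ≤ n)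
    (χ : Finset (Fin k)) (s : Pt k n → ZMod 2) (hs : Ty R χ s) (L : List (Pt k n → ZMod 2))
    (hL : ∀ s ∈ L, ∃ χ, Ty R χ s) :
    E R e (s :: L) = ∑ i ∈ χ, if 1 ≤ e i then E R (e - Finsupp.single i 1) L else 0 := by
  classical
  have hinv := inv_W hR L hL
  have h1 : ∀ w, W (s :: L) w = (∑ i ∈ χ, bd (fun p => bit (gs p i) * W L p) w)
      + bd (fun p => (s p + s0 χ p) * W L p) w := by
    intro w
    rw [← bd_sum, ← bd_add]
    change bd (fun p => s p * W L p) w = _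
    congr 1
    funext p
    rw [← Finset.sum_mul]
    change _ = s0 χ p * W L p + _
    linear_combination (- W L p) * z2 (s0 χ p)
  unfold E
  rw [Finset.sum_congr rfl (fun w _ => h1 w), Finset.sum_add_distrib]
  have h2 : ∑ w ∈ (Box k n R).filter (fun w => Top R e w ∧ gs w = 1),
      bd (fun p => (s p + s0 χ p) * W L p) w = 0 := by
    unfold bd
    rw [reindex hR hR0 e (fun v _ => (s v + s0 χ v) * W L v)]
    · apply Finset.sum_eq_zero
      intro v _
      have := coverA hR hR0 e v
      apply_fun (fun t => ((s v + s0 χ v) * W L v) * t) at this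
      rw [Finset.mul_sum] at this
      simpa using this
    · intro v w hv _ g
      have := ty_add hs (ty_s0 hR0 χ) v hv g
      dsimp only at this ⊢
      rw [this, hinv v hv]
  rw [h2, add_zero, Finset.sum_comm]
  apply Finset.sum_congr rfl
  intro i _
  simp_rw [bd_mul_W]
  rw [reindex hR hR0 e (fun v w => W L v * (bit (gs v i) + bit (gs w i)))]
  · have h3 : ∀ v : Pt k n, (∑ x : (Fin k × Fin (n + 1)) × ℤˣ,
        (if Even (v x.1) ∧ Top R e (stp x.1 x.2 v) then
          W L v * (bit (gs v i) + bit (gs (stp x.1 x.2 v) i)) else 0)) =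
        if 1 ≤ e i ∧ Top R (e - Finsupp.single i 1) v then W L v else 0 := by
      intro v
      have := coverB hR hR0 e he v i
      apply_fun (fun t => W L v * t) at this
      rw [Finset.mul_sum] at this
      simpa using this
    rw [Finset.sum_congr rfl (fun v _ => h3 v)]
    by_cases hei : 1 ≤ e i
    · simp only [hei, true_and, if_true]
      rw [← Finset.sum_filter, Finset.filter_filter]
      congr 1
      ext v
      simp only [mem_filter]
      tauto
    · simp [hei]
  · intro v w hv hw g
    rw [hinv v hv, gs_act hR0 hv, gs_act hR0 hw, Pi.mul_apply, Pi.mul_apply, bit_mul, bit_mul]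
    linear_combination (W L v) * z2 (bit (g i))

theorem E_nil (hR : Even R) (hR0 : 0 < R) : E (k := k) (n := n) R 0 [] = 1 := by
  classical
  unfold E
  set p0 : Pt k n := fun c => if c.2 = 0 then R else 0 with hp0
  have h0 : ∀ i, gs p0 i = 1 := by
    intro i
    unfold gs
    rw [sg_eq 0]
    · simp [hp0, hR0]
    · simp [hp0]; omega
    · intro b hb
      simp [hp0, hb.ne']
  have htop : Top R 0 p0 := by
    intro i
    refine ⟨0, by simp, by simp [hp0, hR0.le], ?_, ?_⟩
    · intro b hb hb0
      exfalso; apply hb0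
      apply Fin.ext
      simpa using hb
    · intro b hb
      have : b ≠ 0 := by rintro rfl; simp at hb
      simp [hp0, this]
  have : (Box k n R).filter (fun w => Top R 0 w ∧ gs w = 1) = {p0} := by
    ext w
    rw [mem_filter, mem_singleton]
    constructor
    · rintro ⟨_, ht, hg⟩
      funext c
      obtain ⟨i, b⟩ := c
      obtain ⟨a, h1, h2, h3, h4⟩ := ht i
      have ha : a = 0 := by apply Fin.ext; simpa using h1
      subst ha
      by_cases hb : b = 0
      · subst hb
        have hgi := congrFun hg i
        unfold gs at hgi
        rw [sg_eq 0 (by intro h; simp only at h h2; rw [h] at h2; simp at h2; omega)] at hgi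
        · simp only [hp0, if_true]
          split_ifs at hgi with hpos
          · rwa [abs_of_pos hpos] at h2
          · exact absurd hgi (by rw [Pi.one_apply]; decide)
        · intro b hb
          exact h4 b hb
      · have := h4 b (by simpa using Fin.pos_of_ne_zero hb)
        simpa [hp0, hb] using this
    · rintro rfl
      exact ⟨mem_box.2 (top_box hR0 htop), htop, funext h0⟩
  rw [this, Finset.sum_singleton]
  rfl

/-- The evaluation is the coefficient of the product of the linear forms. -/
theorem E_eq (hR : Even R) (hR0 : 0 < R) (L : List (Finset (Fin k) × (Pt k n → ZMod 2)))
    (hL : ∀ s ∈ L, Ty R s.1 s.2) (e : Fin k →₀ ℕ) (he : ∀ i, e i ≤ n) (hlen : e.degree = L.length) :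
    E R e (L.map Prod.snd) = MvPolynomial.coeff e
      ((L.map (fun s => ∑ i ∈ s.1, (MvPolynomial.X i : MvPolynomial (Fin k) (ZMod 2)))).prod) := by
  induction L generalizing e with
  | nil =>
    have : e = 0 := by simpa [Finsupp.degree_eq_zero_iff] using hlen
    subst this
    simpa using E_nil hR hR0
  | cons s L ih =>
    rw [List.map_cons, E_cons hR hR0 e he s.1 s.2 (hL s (by simp)), List.map_cons, List.prod_cons,
      mul_comm, Finset.mul_sum, MvPolynomial.coeff_sum]
    · apply Finset.sum_congr rfl
      intro i _
      rw [MvPolynomial.coeff_mul_X']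
      have hsupp : i ∈ e.support ↔ 1 ≤ e i := by
        rw [Finsupp.mem_support_iff]; omega
      simp only [hsupp]
      split_ifs with h
      · apply ih (fun t ht => hL t (by simp [ht]))
        · intro j
          have := he j
          simp only [Finsupp.coe_tsub, Pi.sub_apply]
          omega
        · have hle : Finsupp.single i 1 ≤ e := by simpa using h
          have h2 : (e - Finsupp.single i 1) + Finsupp.single i 1 = e := tsub_add_cancel_of_le hle
          have h3 := congrArg Finsupp.degree h2
          rw [map_add, Finsupp.degree_single, hlen] at h3
          simpa using h3
      · rfl
    · intro t ht
      obtain ⟨u, hu, rfl⟩ := List.mem_map.1 ht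
      exact ⟨u.1, hL u (by simp [hu])⟩

theorem chain (hR : Even R) (L : List (Pt k n → ZMod 2)) (w : Pt k n) (hw : Good R w)
    (hne : W L w ≠ 0) : ∀ s ∈ L, ∃ v v', Good R v ∧ Good R v' ∧ (∀ c, |v c - w c| ≤ L.length) ∧
      (∀ c, |v' c - w c| ≤ L.length) ∧ s v ≠ s v' := by
  induction L generalizing w with
  | nil => simp
  | cons s L ih =>
    change bd (fun p => s p * W L p) w ≠ 0 at hne
    rw [bd_mul_W] at hne
    obtain ⟨⟨c, ε⟩, _, hx⟩ := Finset.exists_ne_zero_of_sum_ne_zero hne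
    dsimp only at hx
    split_ifs at hx with ho
    · have hg := good_stp hR hw ho ε
      have hd : ∀ b, |stp c ε w b - w b| ≤ 1 := by
        intro b
        by_cases hb : b = c
        · subst hb; rw [stp_same]; rcases unit_cases ε with h | h <;> simp [h]
        · rw [stp_ne hb]; simp
      intro t ht
      rcases List.mem_cons.1 ht with rfl | ht
      · refine ⟨stp c ε w, w, hg, hw, ?_, ?_, ?_⟩
        · intro b
          have := hd b
          push_cast [List.length_cons]; linarith [Int.natCast_nonneg L.length]
        · intro b; simp; positivity
        · intro heq
          apply hx
          rw [heq, z2, mul_zero]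
      · obtain ⟨v, v', h1, h2, h3, h4, h5⟩ := ih _ hg (left_ne_zero_of_mul hx) t ht
        refine ⟨v, v', h1, h2, ?_, ?_, h5⟩
        · intro b
          have := abs_sub_le (v b) (stp c ε w b) (w b)
          have := h3 b
          have := hd b
          push_cast [List.length_cons]; linarith
        · intro b
          have := abs_sub_le (v' b) (stp c ε w b) (w b)
          have := h4 b
          have := hd b
          push_cast [List.length_cons]; linarith
    · exact absurd rfl hx

end RP

namespace RP
open Finset

variable {k n : ℕ} {R : ℤ}

def toR (R : ℤ) (p : Pt k n) : Fin k × Fin (n + 1) → ℝ := fun c => (p c : ℝ) / (R : ℝ)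

theorem prod_bit (χ : Finset (Fin k)) (g : Fin k → ℤˣ) :
    ((∏ i ∈ χ, ((g i : ℤ) : ℝ)) = 1 ∧ ∑ i ∈ χ, bit (g i) = 0) ∨
    ((∏ i ∈ χ, ((g i : ℤ) : ℝ)) = -1 ∧ ∑ i ∈ χ, bit (g i) = 1) := by
  classical
  induction χ using Finset.induction_on with
  | empty => left; simp
  | insert a s ha ih =>
    rw [Finset.prod_insert ha, Finset.sum_insert ha]
    have h1 : bit 1 = 0 := rfl
    have h2 : bit (-1) = 1 := rfl
    have h3 : (1 : ZMod 2) + 1 = 0 := rfl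
    rcases ih with ⟨h, h'⟩ | ⟨h, h'⟩ <;> rw [h, h'] <;>
      rcases Int.units_eq_one_or (g a) with hg | hg <;> rw [hg] <;> simp [h1, h2, h3]

open Classical in
def sOf (R : ℤ) (χ : Finset (Fin k)) (G : (Fin k × Fin (n + 1) → ℝ) → ℝ) (p : Pt k n) : ZMod 2 :=
  if 0 < G (toR R p) then 0 else if G (toR R p) < 0 then 1 else s0 χ p

theorem ty_sOf (hR0 : 0 < R) (χ : Finset (Fin k)) (G : (Fin k × Fin (n + 1) → ℝ) → ℝ)
    (hodd : ∀ (g : Fin k → ℤˣ) x, G (fun c => ((g c.1 : ℤ) : ℝ) * x c) =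
      (∏ i ∈ χ, ((g i : ℤ) : ℝ)) * G x) : Ty R χ (sOf R χ G) := by
  intro p hp g
  have h1 : toR R (act g p) = fun c => ((g c.1 : ℤ) : ℝ) * toR R p c := by
    funext c
    simp only [toR, act]
    push_cast
    ring
  have h2 := ty_s0 (n := n) hR0 χ p hp g
  unfold sOf
  rw [h1, hodd, h2]
  have h3 : (1 : ZMod 2) + 1 = 0 := rfl
  rcases prod_bit χ g with ⟨h, h'⟩ | ⟨h, h'⟩ <;> rw [h, h']
  · simp
  · rcases lt_trichotomy (G (toR R p)) 0 with hG | hG | hG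
    · simp [hG, hG.le, not_lt.2 hG.le, h3]
    · simp [hG]
    · simp [hG, not_lt.2 hG.le]

theorem sOf_ne {χ : Finset (Fin k)} {G : (Fin k × Fin (n + 1) → ℝ) → ℝ} {v v' : Pt k n}
    (h : sOf R χ G v ≠ sOf R χ G v') : G (toR R v) * G (toR R v') ≤ 0 := by
  by_contra hc
  push Not at hc
  apply h
  unfold sOf
  rcases pos_and_pos_or_neg_and_neg_of_mul_pos hc with ⟨h1, h2⟩ | ⟨h1, h2⟩
  · simp [h1, h2]
  · simp [h1, h2, not_lt.2 h1.le, not_lt.2 h2.le]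

theorem discrete (hR : Even R) (hR0 : 0 < R) (e : Fin k →₀ ℕ) (he : ∀ i, e i ≤ n)
    {J : Type} [Fintype J] (χ : J → Finset (Fin k)) (G : J → (Fin k × Fin (n + 1) → ℝ) → ℝ)
    (hodd : ∀ j (g : Fin k → ℤˣ) x, G j (fun c => ((g c.1 : ℤ) : ℝ) * x c) =
      (∏ i ∈ χ j, ((g i : ℤ) : ℝ)) * G j x)
    (hcoef : MvPolynomial.coeff e
      (∏ j, ∑ i ∈ χ j, (MvPolynomial.X i : MvPolynomial (Fin k) (ZMod 2))) ≠ 0) :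
    ∃ w : Pt k n, Good R w ∧ (∀ c, |w c| ≤ R) ∧ ∀ j, ∃ v v' : Pt k n,
      (∀ c, |v c - w c| ≤ Fintype.card J) ∧ (∀ c, |v' c - w c| ≤ Fintype.card J) ∧
      G j (toR R v) * G j (toR R v') ≤ 0 := by
  classical
  set L : List (Finset (Fin k) × (Pt k n → ZMod 2)) :=
    (univ : Finset J).toList.map (fun j => (χ j, sOf R (χ j) (G j))) with hLdef
  have hlenL : L.length = Fintype.card J := by simp [hLdef]
  have hL : ∀ s ∈ L, Ty R s.1 s.2 := by
    intro s hs
    obtain ⟨j, _, rfl⟩ := List.mem_map.1 hs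
    exact ty_sOf hR0 (χ j) (G j) (hodd j)
  have hhom : (∏ j, ∑ i ∈ χ j, (MvPolynomial.X i : MvPolynomial (Fin k) (ZMod 2))).IsHomogeneous
      (∑ _j : J, 1) := by
    apply MvPolynomial.IsHomogeneous.prod
    intro j _
    apply MvPolynomial.IsHomogeneous.sum
    intro i _
    exact MvPolynomial.isHomogeneous_X _ i
  have hdeg : e.degree = L.length := by
    have := hhom hcoef
    rw [hlenL]
    have h2 : e.degree = Finsupp.weight 1 e := by
      rw [Finsupp.degree_eq_weight_one]; rfl
    rw [h2, this]
    simp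
  have hE := E_eq hR hR0 L hL e he hdeg
  have hprod : (L.map (fun s => ∑ i ∈ s.1, (MvPolynomial.X i : MvPolynomial (Fin k) (ZMod 2)))).prod
      = ∏ j, ∑ i ∈ χ j, (MvPolynomial.X i : MvPolynomial (Fin k) (ZMod 2)) := by
    rw [hLdef, List.map_map]
    exact Finset.prod_map_toList univ _
  rw [hprod] at hE
  have hne : E R e (L.map Prod.snd) ≠ 0 := by rw [hE]; exact hcoef
  obtain ⟨w, hw, hW⟩ := Finset.exists_ne_zero_of_sum_ne_zero hne
  rw [mem_filter] at hw
  refine ⟨w, top_good hw.2.1, mem_box.1 hw.1, ?_⟩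
  intro j
  obtain ⟨v, v', _, _, h3, h4, h5⟩ := chain hR _ w (top_good hw.2.1) hW (sOf R (χ j) (G j)) (by
    rw [List.mem_map]
    refine ⟨(χ j, sOf R (χ j) (G j)), ?_, rfl⟩
    rw [hLdef, List.mem_map]
    exact ⟨j, by simp, rfl⟩)
  rw [List.length_map, hlenL] at h3 h4
  exact ⟨v, v', h3, h4, sOf_ne h5⟩

open Filter Topology in
theorem borsuk (e : Fin k →₀ ℕ) (he : ∀ i, e i ≤ n)
    {J : Type} [Fintype J] (χ : J → Finset (Fin k)) (G : J → (Fin k × Fin (n + 1) → ℝ) → ℝ)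
    (hcont : ∀ j, Continuous (G j))
    (hodd : ∀ j (g : Fin k → ℤˣ) x, G j (fun c => ((g c.1 : ℤ) : ℝ) * x c) =
      (∏ i ∈ χ j, ((g i : ℤ) : ℝ)) * G j x)
    (hcoef : MvPolynomial.coeff e
      (∏ j, ∑ i ∈ χ j, (MvPolynomial.X i : MvPolynomial (Fin k) (ZMod 2))) ≠ 0) :
    ∃ x : Fin k × Fin (n + 1) → ℝ, (∀ i, ∃ a, x (i, a) ≠ 0) ∧ ∀ j, G j x = 0 := by
  have hstep := fun N : ℕ => discrete (R := 2 * ((N : ℤ) + 1)) (even_two_mul _) (by positivity)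
    e he χ G hodd hcoef
  choose w hgood hbox v v' hv hv' hG using hstep
  set r : ℕ → ℝ := fun N => 2 * ((N : ℝ) + 1) with hr
  have hrpos : ∀ N, 0 < r N := fun N => by simp only [hr]; positivity
  have hcast : ∀ N : ℕ, ((2 * ((N : ℤ) + 1) : ℤ) : ℝ) = r N := fun N => by simp [hr]
  set K : Set (Fin k × Fin (n + 1) → ℝ) :=
    (Set.univ.pi fun _ => Set.Icc (-1) 1) ∩ {x | ∀ i, ∃ a, |x (i, a)| = 1} with hK
  have hKc : IsCompact K := by
    apply IsCompact.inter_right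
    · exact isCompact_univ_pi (fun _ => isCompact_Icc)
    · have : {x : Fin k × Fin (n + 1) → ℝ | ∀ i, ∃ a, |x (i, a)| = 1} =
        ⋂ i, ⋃ a, {x | |x (i, a)| = 1} := by ext; simp
      rw [this]
      apply isClosed_iInter
      intro i
      apply isClosed_iUnion_of_finite
      intro a
      exact isClosed_eq (by fun_prop) continuous_const
  have hmem : ∀ N : ℕ, toR (2 * ((N : ℤ) + 1)) (w N) ∈ K := by
    intro N
    refine ⟨?_, ?_⟩
    · intro c _
      have h := hbox N c
      have h' : |(w N c : ℝ)| ≤ r N := by rw [← hcast]; exact_mod_cast h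
      rw [Set.mem_Icc, ← abs_le]
      simp only [toR]
      rw [hcast, abs_div, abs_of_pos (hrpos N)]
      exact (div_le_one (hrpos N)).2 h'
    · intro i
      obtain ⟨a, ha⟩ := hgood N i
      refine ⟨a, ?_⟩
      have h' : |(w N (i, a) : ℝ)| = r N := by rw [← hcast, ← ha]; push_cast; rfl
      simp only [toR]
      rw [hcast, abs_div, abs_of_pos (hrpos N), h', div_self (hrpos N).ne']
  obtain ⟨x, hx, φ, hφ, hlim⟩ := hKc.tendsto_subseq hmem
  have hrtop : Tendsto r atTop atTop := by
    simp only [hr]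
    exact Tendsto.const_mul_atTop (by norm_num)
      (tendsto_atTop_add_const_right _ _ tendsto_natCast_atTop_atTop)
  have hclose : ∀ u : ℕ → Pt k n, (∀ N c, |u N c - w N c| ≤ Fintype.card J) →
      Tendsto (fun N => toR (2 * ((φ N : ℤ) + 1)) (u (φ N))) atTop (𝓝 x) := by
    intro u hu
    rw [tendsto_pi_nhds] at hlim ⊢
    intro c
    have h0 : Tendsto (fun N => toR (2 * ((φ N : ℤ) + 1)) (u (φ N)) c -
        toR (2 * ((φ N : ℤ) + 1)) (w (φ N)) c) atTop (𝓝 0) := by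
      apply squeeze_zero_norm (a := fun N => (Fintype.card J : ℝ) / r (φ N))
      · intro N
        simp only [toR]
        rw [hcast, ← sub_div, norm_div, Real.norm_eq_abs, Real.norm_eq_abs, abs_of_pos (hrpos _)]
        apply div_le_div_of_nonneg_right _ (hrpos _).le
        exact_mod_cast hu (φ N) c
      · exact Tendsto.const_div_atTop (hrtop.comp hφ.tendsto_atTop) _
    have := h0.add (hlim c)
    simpa [Function.comp_def] using this
  refine ⟨x, ?_, ?_⟩
  · intro i
    obtain ⟨a, ha⟩ := hx.2 i
    refine ⟨a, ?_⟩
    intro h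
    rw [h] at ha
    simp at ha
  · intro j
    have h1 := ((hcont j).tendsto x).comp (hclose (fun N => v N j) (fun N => hv N j))
    have h2 := ((hcont j).tendsto x).comp (hclose (fun N => v' N j) (fun N => hv' N j))
    have h3 := le_of_tendsto (h1.mul h2) (Eventually.of_forall (fun N => hG (φ N) j))
    nlinarith [mul_self_nonneg (G j x), mul_self_eq_zero.1 (le_antisymm h3 (mul_self_nonneg (G j x)))]

end RP

namespace RP
open Finset MvPolynomial

/-! ### the coefficient computation -/

def Ex {k : ℕ} (σ : Equiv.Perm (Fin k)) : Fin k →₀ ℕ :=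
  Finsupp.equivFunOnFinite.symm (fun i => (σ i : ℕ) + 1)

theorem Ex_apply {k : ℕ} (σ : Equiv.Perm (Fin k)) (i : Fin k) : Ex σ i = (σ i : ℕ) + 1 := rfl

theorem Ex_inj {k : ℕ} {σ τ : Equiv.Perm (Fin k)} (h : ∀ i, (Ex σ i : ℤ) = Ex τ i) : σ = τ := by
  ext i
  have := h i
  rw [Ex_apply, Ex_apply] at this
  omega

def dt {k : ℕ} (a b : Fin k →₀ ℕ) : ℤ := ∑ i, (a i : ℤ) * (b i : ℤ)

theorem dt_add {k : ℕ} (a b c : Fin k →₀ ℕ) : dt (a + b) c = dt a c + dt b c := by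
  unfold dt
  rw [← Finset.sum_add_distrib]
  apply Finset.sum_congr rfl
  intro i _
  rw [Finsupp.add_apply]; push_cast; ring

theorem dt_smul {k : ℕ} (r : ℕ) (a c : Fin k →₀ ℕ) : dt (r • a) c = r * dt a c := by
  unfold dt
  rw [Finset.mul_sum]
  apply Finset.sum_congr rfl
  intro i _
  rw [Finsupp.smul_apply]; push_cast [smul_eq_mul]; ring

def AA (k : ℕ) : ℤ := ∑ i : Fin k, ((i : ℤ) + 1) * ((i : ℤ) + 1)
def BB (k : ℕ) : ℤ := ∑ i : Fin k, ((i : ℤ) + 1)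

variable {k : ℕ}

theorem sum_sq (σ : Equiv.Perm (Fin k)) : ∑ i, (Ex σ i : ℤ) * (Ex σ i : ℤ) = AA k := by
  unfold AA
  conv_rhs => rw [← Equiv.sum_comp σ]
  apply Finset.sum_congr rfl
  intro i _
  rw [Ex_apply]; push_cast; ring

theorem sum_lin (σ : Equiv.Perm (Fin k)) : ∑ i, (Ex σ i : ℤ) = BB k := by
  unfold BB
  conv_rhs => rw [← Equiv.sum_comp σ]
  apply Finset.sum_congr rfl
  intro i _
  rw [Ex_apply]; push_cast; ring

def rv (k : ℕ) : Equiv.Perm (Fin k) := Fin.revPerm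

theorem Ex_rv (σ : Equiv.Perm (Fin k)) (i : Fin k) :
    (Ex (σ.trans (rv k)) i : ℤ) = k + 1 - Ex σ i := by
  rw [Ex_apply, Ex_apply]
  have := (σ i).isLt
  simp only [rv, Equiv.trans_apply, Fin.revPerm_apply, Fin.val_rev]
  omega

theorem dt_le (σ τ : Equiv.Perm (Fin k)) : dt (Ex σ) (Ex τ) ≤ AA k := by
  have h : 0 ≤ ∑ i, ((Ex σ i : ℤ) - Ex τ i) * ((Ex σ i : ℤ) - Ex τ i) :=
    Finset.sum_nonneg (fun i _ => mul_self_nonneg _)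
  have h2 : ∑ i, ((Ex σ i : ℤ) - Ex τ i) * ((Ex σ i : ℤ) - Ex τ i) = AA k + AA k - 2 * dt (Ex σ) (Ex τ) := by
    conv_rhs => rw [← sum_sq σ]
    conv_rhs => arg 1; arg 2; rw [sum_sq σ, ← sum_sq τ]
    unfold dt
    rw [Finset.mul_sum, ← Finset.sum_add_distrib, ← Finset.sum_sub_distrib]
    apply Finset.sum_congr rfl
    intro i _
    ring
  linarith

theorem dt_eq {σ τ : Equiv.Perm (Fin k)} (he : AA k ≤ dt (Ex σ) (Ex τ)) : σ = τ := by
  have h2 : ∑ i, ((Ex σ i : ℤ) - Ex τ i) * ((Ex σ i : ℤ) - Ex τ i) = AA k + AA k - 2 * dt (Ex σ) (Ex τ) := by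
    conv_rhs => rw [← sum_sq σ]
    conv_rhs => arg 1; arg 2; rw [sum_sq σ, ← sum_sq τ]
    unfold dt
    rw [Finset.mul_sum, ← Finset.sum_add_distrib, ← Finset.sum_sub_distrib]
    apply Finset.sum_congr rfl
    intro i _
    ring
  have h : 0 ≤ ∑ i, ((Ex σ i : ℤ) - Ex τ i) * ((Ex σ i : ℤ) - Ex τ i) :=
    Finset.sum_nonneg (fun i _ => mul_self_nonneg _)
  have h3 : ∑ i, ((Ex σ i : ℤ) - Ex τ i) * ((Ex σ i : ℤ) - Ex τ i) = 0 := by linarith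
  rw [Finset.sum_eq_zero_iff_of_nonneg (fun i _ => mul_self_nonneg _)] at h3
  apply Ex_inj
  intro i
  have := mul_self_eq_zero.1 (h3 i (mem_univ i))
  linarith

theorem dt_rv (σ τ : Equiv.Perm (Fin k)) :
    dt (Ex (σ.trans (rv k))) (Ex τ) = (k + 1) * BB k - dt (Ex σ) (Ex τ) := by
  rw [← sum_lin τ]
  unfold dt
  rw [Finset.mul_sum, ← Finset.sum_sub_distrib]
  apply Finset.sum_congr rfl
  intro i _
  rw [Ex_rv]; ring

def mu (k : ℕ) : ℤ := (k + 1) * BB k - AA k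

theorem rv_rv (σ : Equiv.Perm (Fin k)) : (σ.trans (rv k)).trans (rv k) = σ := by
  ext i; simp [rv]

theorem le_dt (σ τ : Equiv.Perm (Fin k)) : mu k ≤ dt (Ex σ) (Ex τ) := by
  have h := dt_le (σ.trans (rv k)) τ
  rw [dt_rv] at h
  unfold mu; linarith

theorem eq_of_dt_le {σ τ : Equiv.Perm (Fin k)} (h : dt (Ex σ) (Ex τ) ≤ mu k) :
    σ = τ.trans (rv k) := by
  have : σ.trans (rv k) = τ := by
    apply dt_eq
    rw [dt_rv]; unfold mu at h; linarith
  rw [← this, rv_rv]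

def PP (k : ℕ) : MvPolynomial (Fin k) (ZMod 2) := ∑ σ : Equiv.Perm (Fin k), monomial (Ex σ) 1

theorem supp_pow (r : ℕ) (e : Fin k →₀ ℕ) (he : coeff e (PP k ^ r) ≠ 0) (π : Equiv.Perm (Fin k)) :
    r * mu k ≤ dt e (Ex π) := by
  classical
  induction r generalizing e with
  | zero =>
    unfold dt
    simp only [Nat.cast_zero, zero_mul]
    positivity
  | succ r ih =>
    rw [pow_succ, coeff_mul] at he
    obtain ⟨⟨a, b⟩, hab, hne⟩ := Finset.exists_ne_zero_of_sum_ne_zero he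
    rw [Finset.HasAntidiagonal.mem_antidiagonal] at hab
    dsimp only at hab hne
    have h1 := ih a (left_ne_zero_of_mul hne)
    have h2 := right_ne_zero_of_mul hne
    unfold PP at h2
    rw [coeff_sum] at h2
    obtain ⟨σ, _, hσ⟩ := Finset.exists_ne_zero_of_sum_ne_zero h2
    rw [coeff_monomial] at hσ
    have hb : Ex σ = b := by
      by_contra h; simp [h] at hσ
    rw [← hab, dt_add, ← hb]
    have := le_dt σ π
    push_cast; linarith

theorem coeff_vertex (r : ℕ) : coeff (r • Ex (rv k)) (PP k ^ r) = 1 := by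
  classical
  induction r with
  | zero => simp
  | succ r ih =>
    rw [pow_succ]
    conv_lhs => arg 2; arg 2; unfold PP
    rw [Finset.mul_sum, coeff_sum, Finset.sum_eq_single (rv k)]
    · rw [coeff_mul_monomial', if_pos, mul_one, succ_nsmul, add_tsub_cancel_right, ih]
      rw [succ_nsmul]; exact le_add_self
    · intro σ _ hσ
      rw [coeff_mul_monomial']
      split_ifs with hle
      · rw [mul_one]
        by_contra hne
        have h1 := supp_pow r _ hne 1
        have h2 : ((r + 1) • Ex (rv k) - Ex σ) + Ex σ = (r + 1) • Ex (rv k) :=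
          tsub_add_cancel_of_le hle
        have h3 := congrArg (fun z => dt z (Ex 1)) h2
        rw [dt_add, dt_smul] at h3
        have h4 : dt (Ex (rv k)) (Ex 1) = mu k := by
          have := dt_rv (k := k) 1 1
          have h5 : dt (Ex (1 : Equiv.Perm (Fin k))) (Ex 1) = AA k := sum_sq 1
          rw [h5] at this
          exact this
        rw [h4] at h3
        push_cast at h3
        have h6 : dt (Ex σ) (Ex 1) ≤ mu k := by linarith
        exact hσ (eq_of_dt_le h6)
      · rfl
    · simp

theorem PP_frob (q : ℕ) : PP k ^ (2 ^ q) = ∑ σ : Equiv.Perm (Fin k), monomial (2 ^ q • Ex σ) 1 := by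
  unfold PP
  rw [sum_pow_char_pow]
  apply Finset.sum_congr rfl
  intro σ _
  rw [monomial_pow, one_pow]

theorem coeff_main (q r : ℕ) (hr : r < 2 ^ q) :
    coeff (2 ^ q • Ex 1 + r • Ex (rv k)) (PP k ^ (2 ^ q + r)) = 1 := by
  classical
  rw [pow_add, PP_frob, Finset.sum_mul, coeff_sum, Finset.sum_eq_single 1]
  · rw [coeff_monomial_mul', if_pos le_self_add, one_mul, add_tsub_cancel_left, coeff_vertex]
  · intro σ _ hσ
    rw [coeff_monomial_mul']
    split_ifs with hle
    · rw [one_mul]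
      by_contra hne
      have h1 := supp_pow r _ hne σ
      have h2 := tsub_add_cancel_of_le hle
      have h3 := congrArg (fun z => dt z (Ex σ)) h2
      rw [dt_add, dt_add, dt_smul, dt_smul, dt_smul] at h3
      have h5 : dt (Ex σ) (Ex σ) = AA k := sum_sq σ
      have h6 : dt (Ex (rv k)) (Ex σ) = (k + 1) * BB k - dt (Ex 1) (Ex σ) := dt_rv 1 σ
      rw [h5, h6] at h3
      apply hσ
      symm
      apply dt_eq
      unfold mu at h1
      have hr' : (0 : ℤ) < ((2 ^ q : ℕ) : ℤ) - r := by
        have : (r : ℤ) < ((2 ^ q : ℕ) : ℤ) := by exact_mod_cast hr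
        linarith
      by_contra hlt
      push Not at hlt
      nlinarith [mul_pos hr' (sub_pos.2 hlt)]
    · rfl
  · simp

theorem PP_eq : (∏ i, (X i : MvPolynomial (Fin k) (ZMod 2))) *
    (∏ p : {p : Fin k × Fin k // p.1 < p.2}, (X p.1.1 + X p.1.2)) = PP k := by
  classical
  have h1 : (∏ p : {p : Fin k × Fin k // p.1 < p.2},
      ((X p.1.1 : MvPolynomial (Fin k) (ZMod 2)) + X p.1.2)) =
      (Matrix.vandermonde (fun i => (X i : MvPolynomial (Fin k) (ZMod 2)))).det := by
    rw [Matrix.det_vandermonde]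
    rw [← Finset.prod_subtype (univ.filter (fun p : Fin k × Fin k => p.1 < p.2)) (by simp)
      (fun p : Fin k × Fin k => (X p.1 : MvPolynomial (Fin k) (ZMod 2)) + X p.2)]
    rw [Finset.prod_filter, ← Finset.univ_product_univ, Finset.prod_product]
    apply Finset.prod_congr rfl
    intro i _
    rw [← Finset.prod_filter]
    apply Finset.prod_congr
    · ext j; simp
    · intro j _
      rw [CharTwo.sub_eq_add, add_comm]
  rw [h1, ← Matrix.det_transpose, Matrix.det_apply, Finset.mul_sum]
  unfold PP
  apply Finset.sum_congr rfl
  intro σ _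
  have h2 : (Equiv.Perm.sign σ) • (∏ i, (Matrix.vandermonde (fun i => (X i : MvPolynomial (Fin k) (ZMod 2)))).transpose (σ i) i)
     = ∏ i, (Matrix.vandermonde (fun i => (X i : MvPolynomial (Fin k) (ZMod 2)))).transpose (σ i) i := by
    rcases Int.units_eq_one_or (Equiv.Perm.sign σ) with h | h <;> rw [h]
    · simp
    · rw [Units.neg_smul, one_smul, CharTwo.neg_eq]
  rw [h2, ← Finset.prod_mul_distrib]
  rw [monomial_eq, C_1, one_mul, Finsupp.prod_fintype _ _ (by simp)]
  apply Finset.prod_congr rfl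
  intro i _
  rw [Matrix.transpose_apply, Matrix.vandermonde_apply, Ex_apply, pow_succ, mul_comm]

end RP

namespace RP
open Finset

/-! ### the algebraic lemma -/

theorem alg {α : Type*} {k : ℕ} (F : Finset α) (p : α → Fin k → ℝ)
    (h1 : ∀ i, ∑ A ∈ F, ∑ l, (if i = l then 0 else p A i * |p A l|) = 0)
    (h2 : ∀ i l, i ≠ l → ∑ A ∈ F, p A i * p A l = 0)
    (h4 : ∀ A ∈ F, ∀ B ∈ F, ∀ C ∈ F, ∀ D ∈ F, (∃ i, p A i * p B i < 0) → (∃ i, p A i * p C i < 0) →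
      (∃ i, p A i * p D i < 0) → (∃ i, p B i * p C i < 0) → (∃ i, p B i * p D i < 0) →
      (∃ i, p C i * p D i < 0) → False) :
    ∀ A ∈ F, ∀ i l, i ≠ l → p A i * p A l = 0 := by
  classical
  have hs : ∀ i, ∃ ε : ℝ, (ε = 1 ∨ ε = -1) ∧ ∀ A ∈ F, ∀ B ∈ F, 0 < ε * p A i → 0 < ε * p B i →
      ¬ ∃ l, p A l * p B l < 0 := by
    intro i
    by_contra hcon
    push Not at hcon
    obtain ⟨A, hA, B, hB, hA1, hB1, hAB⟩ := hcon 1 (Or.inl rfl)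
    obtain ⟨C, hC, D, hD, hC1, hD1, hCD⟩ := hcon (-1) (Or.inr rfl)
    have cf : ∀ x y : ℝ, 0 < 1 * x → 0 < -1 * y → x * y < 0 := by
      intro x y hx hy; nlinarith
    exact h4 A hA B hB C hC D hD hAB ⟨i, cf _ _ hA1 hC1⟩ ⟨i, cf _ _ hA1 hD1⟩ ⟨i, cf _ _ hB1 hC1⟩
      ⟨i, cf _ _ hB1 hD1⟩ hCD
  choose ε hε hε2 using hs
  have habs : ∀ i, |ε i| = 1 := by
    intro i; rcases hε i with h | h <;> rw [h] <;> simp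
  have hsq : ∀ i, ε i * ε i = 1 := by
    intro i; rcases hε i with h | h <;> rw [h] <;> norm_num
  set p' : α → Fin k → ℝ := fun A i => ε i * p A i with hp'
  have hab' : ∀ A i, |p' A i| = |p A i| := by
    intro A i; simp only [hp', abs_mul, habs, one_mul]
  have hmul : ∀ A B i, p' A i * p' B i = p A i * p B i := by
    intro A B i
    simp only [hp']
    linear_combination (p A i * p B i) * hsq i
  have h2' : ∀ i l, i ≠ l → ∑ A ∈ F, p' A i * p' A l = 0 := by
    intro i l hil
    have := h2 i l hil
    have h3 : ∑ A ∈ F, p' A i * p' A l = (ε i * ε l) * ∑ A ∈ F, p A i * p A l := by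
      rw [Finset.mul_sum]
      apply Finset.sum_congr rfl
      intro A _
      simp only [hp']; ring
    rw [h3, this, mul_zero]
  have h1' : ∀ i, ∑ A ∈ F, ∑ l, (if i = l then 0 else p' A i * |p' A l|) = 0 := by
    intro i
    have := h1 i
    have h3 : ∑ A ∈ F, ∑ l, (if i = l then 0 else p' A i * |p' A l|) =
        ε i * ∑ A ∈ F, ∑ l, (if i = l then 0 else p A i * |p A l|) := by
      rw [Finset.mul_sum]
      apply Finset.sum_congr rfl
      intro A _
      rw [Finset.mul_sum]
      apply Finset.sum_congr rfl
      intro l _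
      rw [hab']
      split_ifs
      · simp
      · simp only [hp']; ring
    rw [h3, this, mul_zero]
  have hno : ∀ A ∈ F, ∀ i l, i ≠ l → 0 < p' A i → 0 < p' A l → False := by
    intro A hA i l hil hi hl
    have hex : ∃ B ∈ F, p' B i * p' B l < 0 := by
      by_contra hcon
      push Not at hcon
      have := (Finset.sum_eq_zero_iff_of_nonneg hcon).1 (h2' i l hil) A hA
      have := mul_pos hi hl
      linarith
    obtain ⟨B, hB, hBn⟩ := hex
    rcases lt_trichotomy (p' B i) 0 with h | h | h
    · have hBl : 0 < p' B l := by
        by_contra hh; push Not at hh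
        have := mul_nonneg_of_nonpos_of_nonpos h.le hh
        linarith
      refine hε2 l A hA B hB hl hBl ⟨i, ?_⟩
      rw [← hmul]
      exact mul_neg_of_pos_of_neg hi h
    · rw [h, zero_mul] at hBn; exact lt_irrefl _ hBn
    · have hBl : p' B l < 0 := by
        by_contra hh; push Not at hh
        have := mul_nonneg h.le hh
        linarith
      refine hε2 i A hA B hB hi h ⟨l, ?_⟩
      rw [← hmul]
      exact mul_neg_of_pos_of_neg hl hBl
  have key : ∀ A ∈ F, ∀ i l, i ≠ l → p' A i * |p' A l| + p' A l * |p' A i| + p' A i * p' A l =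
      - (|p' A i| * |p' A l|) := by
    intro A hA i l hil
    have := hno A hA i l hil
    rcases lt_or_ge 0 (p' A i) with h | h <;> rcases lt_or_ge 0 (p' A l) with h' | h'
    · exact (this h h').elim
    · rw [abs_of_pos h, abs_of_nonpos h']; ring
    · rw [abs_of_nonpos h, abs_of_pos h']; ring
    · rw [abs_of_nonpos h, abs_of_nonpos h']; ring
  have htot : ∑ A ∈ F, ∑ i, ∑ l, (if i = l then 0 else |p' A i| * |p' A l|) = 0 := by
    have e1 : ∑ A ∈ F, ∑ i, ∑ l, (if i = l then 0 else p' A i * |p' A l|) = 0 := by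
      rw [Finset.sum_comm]
      exact Finset.sum_eq_zero (fun i _ => h1' i)
    have e2 : ∑ A ∈ F, ∑ i, ∑ l, (if i = l then 0 else p' A l * |p' A i|) = 0 := by
      refine Eq.trans ?_ e1
      apply Finset.sum_congr rfl
      intro A _
      rw [Finset.sum_comm]
      apply Finset.sum_congr rfl
      intro i _
      apply Finset.sum_congr rfl
      intro l _
      simp only [eq_comm]
    have e3 : ∑ A ∈ F, ∑ i, ∑ l, (if i = l then 0 else p' A i * p' A l) = 0 := by
      rw [Finset.sum_comm]
      apply Finset.sum_eq_zero
      intro i _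
      rw [Finset.sum_comm]
      apply Finset.sum_eq_zero
      intro l _
      by_cases h : i = l
      · simp [h]
      · simp only [h, if_false]; exact h2' i l h
    have e4 : ∑ A ∈ F, ∑ i, ∑ l, (if i = l then 0 else |p' A i| * |p' A l|) =
        - (∑ A ∈ F, ∑ i, ∑ l, (if i = l then 0 else p' A i * |p' A l|)
        + ∑ A ∈ F, ∑ i, ∑ l, (if i = l then 0 else p' A l * |p' A i|)
        + ∑ A ∈ F, ∑ i, ∑ l, (if i = l then 0 else p' A i * p' A l)) := by
      simp only [← Finset.sum_add_distrib, ← Finset.sum_neg_distrib]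
      apply Finset.sum_congr rfl
      intro A hA
      apply Finset.sum_congr rfl
      intro i _
      apply Finset.sum_congr rfl
      intro l _
      by_cases h : i = l
      · simp [h]
      · simp only [h, if_false]
        rw [key A hA i l h, neg_neg]
    rw [e4, e1, e2, e3]; simp
  intro A hA i l hil
  have nn : ∀ A i l, 0 ≤ (if i = l then 0 else |p' A i| * |p' A l|) := by
    intro A i l; split_ifs
    · exact le_rfl
    · positivity
  rw [Finset.sum_eq_zero_iff_of_nonneg
    (fun A _ => Finset.sum_nonneg fun i _ => Finset.sum_nonneg fun l _ => nn A i l)] at htot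
  have t1 := htot A hA
  rw [Finset.sum_eq_zero_iff_of_nonneg (fun i _ => Finset.sum_nonneg fun l _ => nn A i l)] at t1
  have t2 := t1 i (mem_univ i)
  rw [Finset.sum_eq_zero_iff_of_nonneg (fun l _ => nn A i l)] at t2
  have t3 := t2 l (mem_univ l)
  rw [if_neg hil, hab', hab', ← abs_mul] at t3
  exact abs_eq_zero.1 t3

/-! ### the cone extension -/

def hh {n d : ℕ} (f : (Fin (n + 1) → ℝ) → EuclideanSpace ℝ (Fin d)) (y : Fin (n + 1) → ℝ) :
    EuclideanSpace ℝ (Fin d) := (∑ v, y v) • f ((∑ v, y v)⁻¹ • y)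

theorem normalize_mem {n : ℕ} {y : Fin (n + 1) → ℝ} (hy : ∀ v, 0 ≤ y v) (hs : 0 < ∑ v, y v) :
    (∑ v, y v)⁻¹ • y ∈ stdSimplex ℝ (Fin (n + 1)) := by
  refine ⟨fun v => ?_, ?_⟩
  · simp only [Pi.smul_apply, smul_eq_mul]
    exact mul_nonneg (inv_nonneg.2 hs.le) (hy v)
  · simp only [Pi.smul_apply, smul_eq_mul]
    rw [← Finset.mul_sum]
    exact inv_mul_cancel₀ hs.ne'

theorem hh_cont {n d : ℕ} (f : (Fin (n + 1) → ℝ) → EuclideanSpace ℝ (Fin d))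
    (hf : ContinuousOn f (stdSimplex ℝ (Fin (n + 1)))) :
    ContinuousOn (hh f) {y | ∀ v, 0 ≤ y v} := by
  intro y hy
  have hsc : Continuous (fun y : Fin (n + 1) → ℝ => ∑ v, y v) :=
    continuous_finsetSum _ (fun v _ => continuous_apply v)
  have hsn : ∀ y ∈ {y : Fin (n + 1) → ℝ | ∀ v, 0 ≤ y v}, 0 ≤ ∑ v, y v :=
    fun y hy => Finset.sum_nonneg (fun v _ => hy v)
  rcases (hsn y hy).eq_or_lt with h0 | hpos
  · obtain ⟨M, hM⟩ := (isCompact_stdSimplex ℝ (Fin (n + 1))).exists_bound_of_continuousOn hf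
    have hy0 : hh f y = 0 := by unfold hh; rw [← h0, zero_smul]
    unfold ContinuousWithinAt
    rw [hy0]
    have hlim : Filter.Tendsto (fun y : Fin (n + 1) → ℝ => (∑ v, y v) * M)
        (nhdsWithin y {y | ∀ v, 0 ≤ y v}) (nhds 0) := by
      have : Filter.Tendsto (fun y : Fin (n + 1) → ℝ => (∑ v, y v) * M) (nhds y)
          (nhds ((∑ v, y v) * M)) := (hsc.mul continuous_const).tendsto y
      rw [← h0, zero_mul] at this
      exact this.mono_left nhdsWithin_le_nhds
    apply squeeze_zero_norm' _ hlim
    filter_upwards [self_mem_nhdsWithin] with z hz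
    unfold hh
    rw [norm_smul, Real.norm_of_nonneg (hsn z hz)]
    rcases (hsn z hz).eq_or_lt with hz0 | hzp
    · rw [← hz0]; simp
    · exact mul_le_mul_of_nonneg_left (hM _ (normalize_mem hz hzp)) hzp.le
  · have hopen : IsOpen {y : Fin (n + 1) → ℝ | 0 < ∑ v, y v} := isOpen_lt continuous_const hsc
    rw [← continuousWithinAt_inter (hopen.mem_nhds hpos)]
    unfold hh
    apply ContinuousWithinAt.smul hsc.continuousWithinAt
    apply ContinuousWithinAt.comp (t := stdSimplex ℝ (Fin (n + 1)))
      (f := fun y : Fin (n + 1) → ℝ => (∑ v, y v)⁻¹ • y)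
    · exact hf _ (normalize_mem hy hpos)
    · exact ((hsc.continuousAt.inv₀ hpos.ne').smul continuousAt_id).continuousWithinAt
    · intro z hz
      exact normalize_mem hz.1 hz.2

end RP

namespace RP
open Finset

/-! ### the test map -/

theorem coeff_total (k d q r : ℕ) (hr : r < 2 ^ q) :
    MvPolynomial.coeff (Finsupp.equivFunOnFinite.symm (fun _ : Fin k => d + 1)
      + (2 ^ q • Ex 1 + r • Ex (rv k)))
    ((∏ i, (MvPolynomial.X i : MvPolynomial (Fin k) (ZMod 2))) ^ (d + 1) * PP k ^ (2 ^ q + r)) = 1 := by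
  have h : (∏ i, (MvPolynomial.X i : MvPolynomial (Fin k) (ZMod 2))) ^ (d + 1) =
      MvPolynomial.monomial (Finsupp.equivFunOnFinite.symm (fun _ : Fin k => d + 1)) 1 := by
    rw [MvPolynomial.monomial_eq, MvPolynomial.C_1, one_mul, Finsupp.prod_fintype _ _ (by simp),
      ← Finset.prod_pow]
    rfl
  rw [h, MvPolynomial.coeff_monomial_mul, one_mul, coeff_main q r hr]

def pp {k n : ℕ} (A : Finset (Fin (n + 1))) (i : Fin k) (x : Fin k × Fin (n + 1) → ℝ) : ℝ :=
  ∏ v ∈ A, max (x (i, v)) 0 - ∏ v ∈ A, max (-x (i, v)) 0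

theorem pp_cont {k n : ℕ} (A : Finset (Fin (n + 1))) (i : Fin k) :
    Continuous (pp (k := k) A i) := by
  unfold pp
  fun_prop

theorem pp_odd {k n : ℕ} (A : Finset (Fin (n + 1))) (i : Fin k) (g : Fin k → ℤˣ)
    (x : Fin k × Fin (n + 1) → ℝ) :
    pp A i (fun c => ((g c.1 : ℤ) : ℝ) * x c) = ((g i : ℤ) : ℝ) * pp A i x := by
  unfold pp
  rcases Int.units_eq_one_or (g i) with h | h <;> simp [h]

theorem prod_max_nonneg {n : ℕ} (A : Finset (Fin (n + 1))) (y : Fin (n + 1) → ℝ) :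
    0 ≤ ∏ v ∈ A, max (y v) 0 := Finset.prod_nonneg (fun _ _ => le_max_right _ _)

theorem pos_of_prod {n : ℕ} {A : Finset (Fin (n + 1))} {y : Fin (n + 1) → ℝ}
    (h : 0 < ∏ v ∈ A, max (y v) 0) : ∀ v ∈ A, 0 < y v := by
  intro v hv
  have := (Finset.prod_ne_zero_iff.1 h.ne') v hv
  by_contra hc
  exact this (max_eq_right (not_lt.1 hc))

theorem pp_pos {k n : ℕ} {A : Finset (Fin (n + 1))} {i : Fin k} {x : Fin k × Fin (n + 1) → ℝ}
    (h : 0 < pp A i x) : ∀ v ∈ A, 0 < x (i, v) := by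
  unfold pp at h
  have := prod_max_nonneg A (fun v => - x (i, v))
  exact pos_of_prod (y := fun v => x (i, v)) (by linarith)

theorem pp_neg {k n : ℕ} {A : Finset (Fin (n + 1))} {i : Fin k} {x : Fin k × Fin (n + 1) → ℝ}
    (h : pp A i x < 0) : ∀ v ∈ A, x (i, v) < 0 := by
  unfold pp at h
  have := prod_max_nonneg A (fun v => x (i, v))
  intro v hv
  have := pos_of_prod (y := fun v => - x (i, v)) (by linarith) v hv
  linarith

theorem pp_ne_of_pos {k n : ℕ} {A : Finset (Fin (n + 1))} {i : Fin k} {x : Fin k × Fin (n + 1) → ℝ}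
    (hA : A.Nonempty) (h : ∀ v ∈ A, 0 < x (i, v)) : pp A i x ≠ 0 := by
  unfold pp
  obtain ⟨w, hw⟩ := hA
  have h1 : ∏ v ∈ A, max (-x (i, v)) 0 = 0 :=
    Finset.prod_eq_zero hw (max_eq_right (by linarith [h w hw]))
  have h2 : 0 < ∏ v ∈ A, max (x (i, v)) 0 :=
    Finset.prod_pos (fun v hv => lt_max_of_lt_left (h v hv))
  rw [h1, sub_zero]; exact h2.ne'

theorem pp_ne_of_neg {k n : ℕ} {A : Finset (Fin (n + 1))} {i : Fin k} {x : Fin k × Fin (n + 1) → ℝ}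
    (hA : A.Nonempty) (h : ∀ v ∈ A, x (i, v) < 0) : pp A i x ≠ 0 := by
  unfold pp
  obtain ⟨w, hw⟩ := hA
  have h1 : ∏ v ∈ A, max (x (i, v)) 0 = 0 :=
    Finset.prod_eq_zero hw (max_eq_right (by linarith [h w hw]))
  have h2 : 0 < ∏ v ∈ A, max (-x (i, v)) 0 :=
    Finset.prod_pos (fun v hv => lt_max_of_lt_left (by linarith [h v hv]))
  rw [h1, zero_sub]; exact (neg_lt_zero.2 h2).ne

theorem conf_disj {k n : ℕ} {A B : Finset (Fin (n + 1))} {x : Fin k × Fin (n + 1) → ℝ}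
    (h : ∃ i, pp A i x * pp B i x < 0) : Disjoint A B := by
  obtain ⟨i, hi⟩ := h
  rw [Finset.disjoint_left]
  intro v hA hB
  rcases mul_neg_iff.1 hi with ⟨h1, h2⟩ | ⟨h1, h2⟩
  · linarith [pp_pos h1 v hA, pp_neg h2 v hB]
  · linarith [pp_neg h1 v hA, pp_pos h2 v hB]

abbrev JJ (k d m : ℕ) : Type :=
  Fin k ⊕ (Fin k × Fin d) ⊕ (Fin m × Fin k) ⊕ (Fin m × {p : Fin k × Fin k // p.1 < p.2})

def chi {k d m : ℕ} : JJ k d m → Finset (Fin k)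
  | .inl i => {i}
  | .inr (.inl a) => {a.1}
  | .inr (.inr (.inl a)) => {a.2}
  | .inr (.inr (.inr a)) => {a.2.1.1, a.2.1.2}

def GG {k d m n : ℕ} (f : (Fin (n + 1) → ℝ) → EuclideanSpace ℝ (Fin d))
    (F : Finset (Finset (Fin (n + 1)))) (c : Finset (Fin (n + 1)) → Fin m) :
    JJ k d m → (Fin k × Fin (n + 1) → ℝ) → ℝ
  | .inl i => fun x => ∑ v, x (i, v)
  | .inr (.inl a) => fun x =>
      hh f (fun v => max (x (a.1, v)) 0) a.2 - hh f (fun v => max (-x (a.1, v)) 0) a.2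
  | .inr (.inr (.inl a)) => fun x => ∑ A ∈ F.filter (fun A => c A = a.1), ∑ l,
      (if a.2 = l then 0 else pp A a.2 x * |pp A l x|)
  | .inr (.inr (.inr a)) => fun x => ∑ A ∈ F.filter (fun A => c A = a.1),
      pp A a.2.1.1 x * pp A a.2.1.2 x

theorem GG_cont {k d m n : ℕ} (f : (Fin (n + 1) → ℝ) → EuclideanSpace ℝ (Fin d))
    (hf : ContinuousOn f (stdSimplex ℝ (Fin (n + 1))))
    (F : Finset (Finset (Fin (n + 1)))) (c : Finset (Fin (n + 1)) → Fin m) (j : JJ k d m) :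
    Continuous (GG f F c j) := by
  rcases j with i | a | a | a
  · simp only [GG]; fun_prop
  · simp only [GG]
    have h1 : Continuous (fun x : Fin k × Fin (n + 1) → ℝ => hh f (fun v => max (x (a.1, v)) 0)) :=
      (hh_cont f hf).comp_continuous (by fun_prop) (fun x v => le_max_right _ _)
    have h2 : Continuous (fun x : Fin k × Fin (n + 1) → ℝ => hh f (fun v => max (-x (a.1, v)) 0)) :=
      (hh_cont f hf).comp_continuous (by fun_prop) (fun x v => le_max_right _ _)
    exact ((EuclideanSpace.proj (𝕜 := ℝ) a.2).continuous.comp h1).sub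
      ((EuclideanSpace.proj (𝕜 := ℝ) a.2).continuous.comp h2)
  · simp only [GG]
    refine continuous_finsetSum _ (fun A _ => continuous_finsetSum _ (fun l _ => ?_))
    split_ifs
    · exact continuous_const
    · exact (pp_cont A _).mul (pp_cont A _).abs
  · simp only [GG]
    exact continuous_finsetSum _ (fun A _ => (pp_cont A _).mul (pp_cont A _))

theorem GG_odd {k d m n : ℕ} (f : (Fin (n + 1) → ℝ) → EuclideanSpace ℝ (Fin d))
    (F : Finset (Finset (Fin (n + 1)))) (c : Finset (Fin (n + 1)) → Fin m) (j : JJ k d m)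
    (g : Fin k → ℤˣ) (x : Fin k × Fin (n + 1) → ℝ) :
    GG f F c j (fun c => ((g c.1 : ℤ) : ℝ) * x c) = (∏ i ∈ chi j, ((g i : ℤ) : ℝ)) * GG f F c j x := by
  rcases j with i | a | a | a
  · simp only [GG, chi, Finset.prod_singleton, Finset.mul_sum]
  · simp only [GG, chi, Finset.prod_singleton]
    rcases Int.units_eq_one_or (g a.1) with h | h <;> simp [h]
  · simp only [GG, chi, Finset.prod_singleton, Finset.mul_sum]
    refine Finset.sum_congr rfl (fun A _ => Finset.sum_congr rfl (fun l _ => ?_))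
    rw [pp_odd, pp_odd, abs_mul]
    have : |((g l : ℤ) : ℝ)| = 1 := by
      rcases Int.units_eq_one_or (g l) with h | h <;> simp [h]
    rw [this]
    split_ifs
    · simp
    · ring
  · simp only [GG, chi]
    rw [Finset.prod_pair a.2.2.ne, Finset.mul_sum]
    refine Finset.sum_congr rfl (fun A _ => ?_)
    rw [pp_odd, pp_odd]; ring

theorem chi_prod (k d m : ℕ) :
    (∏ j : JJ k d m, ∑ i ∈ chi j, (MvPolynomial.X i : MvPolynomial (Fin k) (ZMod 2))) =
    (∏ i, (MvPolynomial.X i : MvPolynomial (Fin k) (ZMod 2))) ^ (d + 1) * PP k ^ m := by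
  have hp : ∀ p : {p : Fin k × Fin k // p.1 < p.2},
      ∑ i ∈ ({p.1.1, p.1.2} : Finset (Fin k)), (MvPolynomial.X i : MvPolynomial (Fin k) (ZMod 2)) =
      MvPolynomial.X p.1.1 + MvPolynomial.X p.1.2 := fun p => Finset.sum_pair p.2.ne
  rw [← PP_eq, Fintype.prod_sum_type, Fintype.prod_sum_type, Fintype.prod_sum_type]
  simp only [Fintype.prod_prod_type, chi, Finset.sum_singleton, hp, Finset.prod_const,
    Finset.card_univ, Fintype.card_fin, Finset.prod_pow]
  ring

theorem radon_of_zero {n d : ℕ} (f : (Fin (n + 1) → ℝ) → EuclideanSpace ℝ (Fin d))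
    (y : Fin (n + 1) → ℝ) (hy : ∃ a, y a ≠ 0) (h0 : ∑ v, y v = 0)
    (h : hh f (fun v => max (y v) 0) = hh f (fun v => max (-y v) 0)) :
    (f '' simplexFace (univ.filter (fun v => 0 < y v)) ∩
      f '' simplexFace (univ.filter (fun v => y v < 0))).Nonempty := by
  have hs : ∑ v, max (y v) 0 = ∑ v, max (-y v) 0 := by
    rw [← sub_eq_zero, ← Finset.sum_sub_distrib]
    refine Eq.trans ?_ h0
    refine Finset.sum_congr rfl (fun v _ => ?_)
    rcases le_total 0 (y v) with h | h
    · rw [max_eq_left h, max_eq_right (by linarith)]; ring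
    · rw [max_eq_right h, max_eq_left (by linarith)]; ring
  have hpos : 0 < ∑ v, max (y v) 0 := by
    obtain ⟨a, ha⟩ := hy
    rcases lt_or_gt_of_ne ha with h | h
    · rw [hs]
      exact Finset.sum_pos' (fun v _ => le_max_right _ _)
        ⟨a, mem_univ a, lt_max_of_lt_left (by linarith)⟩
    · exact Finset.sum_pos' (fun v _ => le_max_right _ _) ⟨a, mem_univ a, lt_max_of_lt_left h⟩
  have hpos' := hpos
  rw [hs] at hpos'
  refine ⟨f ((∑ v, max (y v) 0)⁻¹ • (fun v => max (y v) 0)), ⟨_, ⟨?_, ?_⟩, rfl⟩,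
    ⟨(∑ v, max (-y v) 0)⁻¹ • (fun v => max (-y v) 0), ⟨?_, ?_⟩, ?_⟩⟩
  · exact normalize_mem (fun v => le_max_right _ _) hpos
  · intro v hv
    simp only [mem_filter, mem_univ, true_and, not_lt] at hv
    simp [hv]
  · exact normalize_mem (fun v => le_max_right _ _) hpos'
  · intro v hv
    simp only [mem_filter, mem_univ, true_and, not_lt] at hv
    simp [hv]
  · unfold hh at h
    simp only [← hs] at h ⊢
    exact (smul_right_injective _ hpos.ne' h).symm

end RP

theorem stmt_17 (d q t k n : ℕ) (hd : 1 ≤ d) (ht1 : 1 ≤ t) (ht2 : t ≤ 2 ^ q)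
    (hk : 2 ≤ k) (m : ℕ) (hm : m = 2 ^ (q + 1) - t)
    (hn : n ≥ d + (2 ^ q * (k + 1) - t) + 1)
    (F : Finset (Finset (Fin (n + 1))))
    (hFne : ∀ A ∈ F, A.Nonempty)
    (c : Finset (Fin (n + 1)) → Fin m)
    -- no 4 pairwise disjoint members of F receive the same color
    (hc : ∀ G : Finset (Finset (Fin (n + 1))), G ⊆ F → G.card = 4 →
      (∀ A ∈ G, ∀ B ∈ G, A ≠ B → Disjoint A B) → ¬ ∃ j, ∀ A ∈ G, c A = j)
    (f : (Fin (n + 1) → ℝ) → EuclideanSpace ℝ (Fin d))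
    (hf : ContinuousOn f (stdSimplex ℝ (Fin (n + 1)))) :
    ∃ S T : Fin k → Finset (Fin (n + 1)),
      (∀ i, Disjoint (S i) (T i)) ∧
      -- each (S i, T i) is a Radon pair for f
      (∀ i, (f '' simplexFace (S i) ∩ f '' simplexFace (T i)).Nonempty) ∧
      -- no intersection of one set from each of two pairs contains a member of F
      (∀ i₁ i₂ : Fin k, i₁ < i₂ →
        ∀ A₁ ∈ ({S i₁, T i₁} : Set (Finset (Fin (n + 1)))),
        ∀ A₂ ∈ ({S i₂, T i₂} : Set (Finset (Fin (n + 1)))),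
        ∀ B ∈ F, ¬ B ⊆ A₁ ∩ A₂) := by
  classical
  obtain ⟨r, hr⟩ : ∃ r, 2 ^ q = r + t := ⟨2 ^ q - t, by omega⟩
  have hm' : m = 2 ^ q + r := by rw [pow_succ] at hm; omega
  have hrlt : r < 2 ^ q := by omega
  obtain ⟨x, hx0, hx⟩ := RP.borsuk (n := n)
    (Finsupp.equivFunOnFinite.symm (fun _ : Fin k => d + 1) + (2 ^ q • RP.Ex 1 + r • RP.Ex (RP.rv k)))
    (by
      intro i
      have h1 : (Finsupp.equivFunOnFinite.symm (fun _ : Fin k => d + 1) +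
          (2 ^ q • RP.Ex 1 + r • RP.Ex (RP.rv k)) : Fin k →₀ ℕ) i =
          (d + 1) + (2 ^ q * ((i : ℕ) + 1) + r * ((k - (i + 1)) + 1)) := by
        rw [Finsupp.add_apply, Finsupp.add_apply, Finsupp.smul_apply, Finsupp.smul_apply,
          RP.Ex_apply, RP.Ex_apply]
        simp [RP.rv, Fin.val_rev]
      rw [h1]
      obtain ⟨s, hs⟩ : ∃ s, k = (i : ℕ) + 1 + s := ⟨k - (i + 1), by have := i.isLt; omega⟩
      have h2 : k - ((i : ℕ) + 1) = s := by omega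
      rw [h2]
      have h3 : 2 ^ q * (k + 1) = 2 ^ q * ((i : ℕ) + 1) + 2 ^ q * s + 2 ^ q := by
        have h6 : k + 1 = ((i : ℕ) + 1) + s + 1 := by omega
        rw [h6]; ring
      have h4 : r * s ≤ 2 ^ q * s := Nat.mul_le_mul_right _ hrlt.le
      have h5 : r * (s + 1) = r * s + r := by ring
      rw [h5]
      omega)
    (RP.chi (k := k) (d := d) (m := m)) (RP.GG f F c) (RP.GG_cont f hf F c) (RP.GG_odd f F c)
    (by
      rw [RP.chi_prod, hm', RP.coeff_total k d q r hrlt]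
      exact one_ne_zero)
  have hmain : ∀ A ∈ F, ∀ i l, i ≠ l → RP.pp A i x * RP.pp A l x = 0 := by
    intro A₀ hA₀
    have hmem : ∀ A, A ∈ F.filter (fun A => c A = c A₀) ↔ A ∈ F ∧ c A = c A₀ := by
      intro A; exact Finset.mem_filter
    refine RP.alg (F.filter (fun A => c A = c A₀)) (fun A i => RP.pp A i x) ?_ ?_ ?_ A₀
      ((hmem A₀).2 ⟨hA₀, rfl⟩)
    · intro i
      exact hx (.inr (.inr (.inl (c A₀, i))))
    · intro i l hil
      rcases lt_or_gt_of_ne hil with h | h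
      · exact hx (.inr (.inr (.inr (c A₀, ⟨(i, l), h⟩))))
      · have := hx (.inr (.inr (.inr (c A₀, ⟨(l, i), h⟩))))
        simp only [RP.GG] at this
        rw [← this]
        exact Finset.sum_congr rfl (fun A _ => mul_comm _ _)
    · intro A hA B hB C hC D hD hAB hAC hAD hBC hBD hCD
      rw [hmem] at hA hB hC hD
      have dAB := RP.conf_disj hAB
      have dAC := RP.conf_disj hAC
      have dAD := RP.conf_disj hAD
      have dBC := RP.conf_disj hBC
      have dBD := RP.conf_disj hBD
      have dCD := RP.conf_disj hCD
      have hne : ∀ X Y : Finset (Fin (n + 1)), X ∈ F → Disjoint X Y → X ≠ Y := by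
        intro X Y hX hXY hEq
        subst hEq
        exact (hFne X hX).ne_empty (disjoint_self.1 hXY)
      apply hc {A, B, C, D}
      · intro X hX
        simp only [Finset.mem_insert, Finset.mem_singleton] at hX
        rcases hX with rfl | rfl | rfl | rfl
        exacts [hA.1, hB.1, hC.1, hD.1]
      · rw [Finset.card_insert_of_notMem, Finset.card_insert_of_notMem, Finset.card_insert_of_notMem,
          Finset.card_singleton]
        · simpa using hne _ _ hC.1 dCD
        · simpa using ⟨hne _ _ hB.1 dBC, hne _ _ hB.1 dBD⟩
        · simpa using ⟨hne _ _ hA.1 dAB, hne _ _ hA.1 dAC, hne _ _ hA.1 dAD⟩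
      · intro X hX Y hY hXY
        simp only [Finset.mem_insert, Finset.mem_singleton] at hX hY
        rcases hX with rfl | rfl | rfl | rfl <;> rcases hY with rfl | rfl | rfl | rfl <;>
          first
          | exact absurd rfl hXY
          | assumption
          | (apply Disjoint.symm; assumption)
      · refine ⟨c A₀, ?_⟩
        intro X hX
        simp only [Finset.mem_insert, Finset.mem_singleton] at hX
        rcases hX with rfl | rfl | rfl | rfl
        exacts [hA.2, hB.2, hC.2, hD.2]
  refine ⟨fun i => Finset.univ.filter (fun v => 0 < x (i, v)),
    fun i => Finset.univ.filter (fun v => x (i, v) < 0), ?_, ?_, ?_⟩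
  · intro i
    rw [Finset.disjoint_left]
    intro v h1 h2
    simp only [Finset.mem_filter, Finset.mem_univ, true_and] at h1 h2
    linarith
  · intro i
    refine RP.radon_of_zero f (fun v => x (i, v)) (hx0 i) (hx (.inl i)) ?_
    ext a
    exact sub_eq_zero.1 (hx (.inr (.inl (i, a))))
  · intro i₁ i₂ hlt A₁ hA₁ A₂ hA₂ B hB hsub
    have hpne : ∀ i : Fin k, ∀ A ∈ ({Finset.univ.filter (fun v => 0 < x (i, v)),
        Finset.univ.filter (fun v => x (i, v) < 0)} : Set (Finset (Fin (n + 1)))),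
        B ⊆ A → RP.pp B i x ≠ 0 := by
      intro i A hA hBA
      rcases hA with rfl | hA
      · exact RP.pp_ne_of_pos (hFne B hB) (fun v hv => (Finset.mem_filter.1 (hBA hv)).2)
      · rw [Set.mem_singleton_iff] at hA
        subst hA
        exact RP.pp_ne_of_neg (hFne B hB) (fun v hv => (Finset.mem_filter.1 (hBA hv)).2)
    exact mul_ne_zero (hpne i₁ A₁ hA₁ (hsub.trans Finset.inter_subset_left))
      (hpne i₂ A₂ hA₂ (hsub.trans Finset.inter_subset_right)) (hmain B hB i₁ i₂ hlt.ne)
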